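/- Let k ≥ 5 and t ≥ 1 be integers. There exists n₀ such that for all n ≥ n₀, the maximum number of edges in a k-uniform hypergraph on n vertices containing no k-uniform linear cycle of length 2t+2 is exactly C(n,k) − C(n−t,k) + C(n−t−2, k−2). -/

import Mathlib

/-- A `k`-uniform linear cycle of length `ℓ`: a cyclic list of `k`-sets such that
consecutive sets (cyclically) intersect in exactly one element and
nonconsecutive sets are disjoint. -/
def IsLinearCycle (k ℓ : ℕ) {n : ℕ} (A : ZMod ℓ → Finset (Fin n)) : Prop :=
  Function.Injective A ∧ (∀ i, (A i).card = k) ∧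
  (∀ i, (A i ∩ A (i + 1)).card = 1) ∧
  (∀ i j : ZMod ℓ, j ≠ i → j ≠ i + 1 → i ≠ j + 1 → Disjoint (A i) (A j))

/-- `S` is an `s`-kernel of the family `H` if, for every set `U` of at most `s` points, some member
of `H` contains `S` and avoids `U` outside of `S`. -/
def IsKernel {α : Type*} [DecidableEq α] (H : Finset (Finset α)) (s : ℕ) (S : Finset α) : Prop :=
  ∀ U : Finset α, U.card ≤ s → ∃ e ∈ H, S ⊆ e ∧ Disjoint (e \ S) U

noncomputable instance {α : Type*} [DecidableEq α] (H : Finset (Finset α)) (s : ℕ)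
    (S : Finset α) : Decidable (IsKernel H s S) := Classical.propDecidable _

section Kernel

variable {α : Type*} [DecidableEq α] {H : Finset (Finset α)} {s k : ℕ}

theorem isKernel_of_mem {e : Finset α} (he : e ∈ H) : IsKernel H s e :=
  fun U _ => ⟨e, he, subset_rfl, by simp⟩

theorem IsKernel.card_le {S : Finset α} (h : IsKernel H s S) (hk : ∀ e ∈ H, e.card = k) :
    S.card ≤ k := by
  obtain ⟨e, he, hS, -⟩ := h ∅ (by simp)
  exact hk e he ▸ Finset.card_le_card hS

/-- Kernels extend to edges that meet only inside the kernels. -/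
theorem exists_edges_of_isKernel {ι : Type*} [Fintype ι] [DecidableEq ι]
    (hk : ∀ e ∈ H, e.card = k) (hs : 2 * k * Fintype.card ι ≤ s)
    (S : ι → Finset α) (hS : ∀ i, IsKernel H s (S i)) :
    ∃ E : ι → Finset α, (∀ i, E i ∈ H) ∧ (∀ i, S i ⊆ E i) ∧
      ∀ i j, i ≠ j → E i ∩ E j = S i ∩ S j := by
  have key : ∀ A : Finset ι, ∃ E : ι → Finset α, ∀ i ∈ A, E i ∈ H ∧ S i ⊆ E i ∧
      Disjoint (E i \ S i) (Finset.univ.biUnion S) ∧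
      ∀ j ∈ A, i ≠ j → Disjoint (E i \ S i) (E j \ S j) := by
    intro A
    induction A using Finset.induction_on with
    | empty => exact ⟨S, by simp⟩
    | insert a A ha ih =>
      obtain ⟨E, hE⟩ := ih
      have hU : (Finset.univ.biUnion S ∪ A.biUnion E).card ≤ s := by
        have h1 : (Finset.univ.biUnion S).card ≤ Fintype.card ι * k :=
          Finset.card_biUnion_le_card_mul _ _ _ fun i _ => (hS i).card_le hk
        have h2 : (A.biUnion E).card ≤ Fintype.card ι * k :=
          (Finset.card_biUnion_le_card_mul _ _ k fun i hi => (hk _ (hE i hi).1).le).trans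
            (Nat.mul_le_mul_right _ (Finset.card_le_univ A))
        have h3 := Finset.card_union_le (Finset.univ.biUnion S) (A.biUnion E)
        nlinarith
      obtain ⟨e, he, hSe, hd⟩ := hS a _ hU
      rw [Finset.disjoint_union_right] at hd
      have hdj : ∀ j ∈ A, Disjoint (e \ S a) (E j \ S j) := fun j hj =>
        hd.2.mono_right (Finset.sdiff_subset.trans (Finset.subset_biUnion_of_mem E hj))
      have hne : ∀ j ∈ A, j ≠ a := fun j hj h => ha (h ▸ hj)
      refine ⟨Function.update E a e, fun i hi => ?_⟩
      rcases Finset.mem_insert.1 hi with rfl | hiA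
      · refine ⟨by simpa using he, by simpa using hSe, by simpa using hd.1, fun j hj hij => ?_⟩
        rcases Finset.mem_insert.1 hj with rfl | hj
        · exact absurd rfl hij
        · simpa [Function.update_of_ne (hne j hj)] using hdj j hj
      · obtain ⟨h1, h2, h3, h4⟩ := hE i hiA
        rw [Function.update_of_ne (hne i hiA)]
        refine ⟨h1, h2, h3, fun j hj hij => ?_⟩
        rcases Finset.mem_insert.1 hj with rfl | hj
        · simpa using (hdj i hiA).symm
        · simpa [Function.update_of_ne (hne j hj)] using h4 j hj hij
  obtain ⟨E, hE⟩ := key Finset.univ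
  refine ⟨E, fun i => (hE i (by simp)).1, fun i => (hE i (by simp)).2.1, fun i j hij => ?_⟩
  obtain ⟨-, hSi, hdi, hij'⟩ := hE i (by simp)
  obtain ⟨-, hSj, hdj, -⟩ := hE j (by simp)
  have hij' := hij' j (by simp) hij
  refine Finset.Subset.antisymm (fun y hy => ?_) (Finset.inter_subset_inter hSi hSj)
  rw [Finset.mem_inter] at hy ⊢
  rw [Finset.disjoint_left] at hdi hdj hij'
  have h1 : y ∈ S i ∨ y ∈ S j := by
    by_contra! h
    exact hij' (Finset.mem_sdiff.2 ⟨hy.1, h.1⟩) (Finset.mem_sdiff.2 ⟨hy.2, h.2⟩)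
  have mem : ∀ i, y ∈ S i → y ∈ Finset.univ.biUnion S := fun i hi =>
    Finset.mem_biUnion.2 ⟨i, by simp, hi⟩
  constructor
  · by_contra h
    exact hdi (Finset.mem_sdiff.2 ⟨hy.1, h⟩) (mem j (h1.resolve_left h))
  · by_contra h
    exact hdj (Finset.mem_sdiff.2 ⟨hy.2, h⟩) (mem i (h1.resolve_right h))

theorem exists_injOn_choice [Nonempty α] {m : ℕ} (N : ℕ → Finset α) (U : Finset α)
    (hN : ∀ i < m, m + U.card ≤ (N i).card) :
    ∃ c : ℕ → α, (∀ i < m, ∀ j < m, c i = c j → i = j) ∧ ∀ i < m, c i ∈ N i ∧ c i ∉ U := by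
  have key : ∀ r ≤ m, ∃ c : ℕ → α, (∀ i < r, ∀ j < r, c i = c j → i = j) ∧
      ∀ i < r, c i ∈ N i ∧ c i ∉ U := by
    intro r
    induction r with
    | zero => exact fun _ => ⟨fun _ => Classical.arbitrary α, by simp, by simp⟩
    | succ r ih =>
      intro hr
      obtain ⟨c, hc, hcN⟩ := ih (by omega)
      have : (U ∪ (Finset.range r).image c).card < (N r).card := by
        have h1 := Finset.card_union_le U ((Finset.range r).image c)
        have h2 := Finset.card_image_le (s := Finset.range r) (f := c)
        have h3 := hN r (by omega)
        simp at h2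
        omega
      obtain ⟨y, hy, hyU⟩ := Finset.exists_mem_notMem_of_card_lt_card this
      simp only [Finset.mem_union, Finset.mem_image, Finset.mem_range, not_or, not_exists,
        not_and] at hyU
      refine ⟨Function.update c r y, fun i hi j hj hij => ?_, fun i hi => ?_⟩
      · rcases Nat.lt_succ_iff_lt_or_eq.1 hi with hi | rfl <;>
          rcases Nat.lt_succ_iff_lt_or_eq.1 hj with hj | rfl
        · rw [Function.update_of_ne hi.ne, Function.update_of_ne hj.ne] at hij
          exact hc i hi j hj hij
        · rw [Function.update_of_ne hi.ne, Function.update_self] at hij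
          exact absurd hij (hyU.2 i hi)
        · rw [Function.update_of_ne hj.ne, Function.update_self] at hij
          exact absurd hij.symm (hyU.2 j hj)
        · rfl
      · rcases Nat.lt_succ_iff_lt_or_eq.1 hi with hi | rfl
        · rw [Function.update_of_ne hi.ne]
          exact hcN i hi
        · rw [Function.update_self]
          exact ⟨hy, hyU.1⟩
  exact key m le_rfl

end Kernel

section Cycle

variable {n k s ℓ : ℕ} {H : Finset (Finset (Fin n))}

/-- A cyclic sequence of kernels in which only neighbours meet, in one point each, gives rise to a
linear cycle. -/
theorem exists_linearCycle_of_kernels (hk : ∀ e ∈ H, e.card = k) (hk2 : 2 ≤ k) (hℓ : 3 ≤ ℓ)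
    (hs : 2 * k * ℓ ≤ s) (v : ℕ → Fin n) (S : ℕ → Finset (Fin n))
    (hS : ∀ i < ℓ, IsKernel H s (S i)) (hv : ∀ i < ℓ, v i ∈ S i)
    (hv' : ∀ i, i + 1 < ℓ → v (i + 1) ∈ S i) (hv0 : v 0 ∈ S (ℓ - 1))
    (hmeet : ∀ i j, i < j → j < ℓ → ∀ y ∈ S i, y ∈ S j →
      (j = i + 1 ∧ y = v j) ∨ (i = 0 ∧ j = ℓ - 1 ∧ y = v 0)) :
    ∃ A : ZMod ℓ → Finset (Fin n), IsLinearCycle k ℓ A ∧ ∀ i, A i ∈ H := by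
  have : NeZero ℓ := ⟨by omega⟩
  have : Fact (1 < ℓ) := ⟨by omega⟩
  obtain ⟨A, hA, -, hAA⟩ := exists_edges_of_isKernel (ι := ZMod ℓ) hk (by rwa [ZMod.card])
    (fun i => S i.val) (fun i => hS _ i.val_lt)
  have hsucc : ∀ i : ZMod ℓ, (i.val + 1 < ℓ ∧ (i + 1).val = i.val + 1) ∨
      (i.val = ℓ - 1 ∧ (i + 1).val = 0) := by
    intro i
    have := i.val_lt
    rw [ZMod.val_add, ZMod.val_one]
    rcases Nat.lt_or_ge (i.val + 1) ℓ with h | h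
    · exact Or.inl ⟨h, Nat.mod_eq_of_lt h⟩
    · have : i.val + 1 = ℓ := by omega
      exact Or.inr ⟨by omega, by rw [this, Nat.mod_self]⟩
  have hval : ∀ i j : ZMod ℓ, i ≠ j → i.val ≠ j.val := fun i j h h' => h (ZMod.val_injective ℓ h')
  have hne : ∀ i : ZMod ℓ, i ≠ i + 1 := by
    intro i h
    rcases hsucc i with h' | h' <;> rw [← h] at h' <;> omega
  have hone : ∀ i, (A i ∩ A (i + 1)).card = 1 := by
    intro i
    rw [hAA _ _ (hne i), Finset.card_eq_one]
    rcases hsucc i with ⟨h1, h2⟩ | ⟨h1, h2⟩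
    · refine ⟨v (i.val + 1), Finset.Subset.antisymm (fun y hy => ?_) ?_⟩
      · rw [Finset.mem_inter, h2] at hy
        rcases hmeet _ _ (Nat.lt_succ_self _) h1 y hy.1 hy.2 with h | h
        · simp [h.2]
        · omega
      · rw [Finset.singleton_subset_iff, Finset.mem_inter, h2]
        exact ⟨hv' _ h1, hv _ h1⟩
    · refine ⟨v 0, Finset.Subset.antisymm (fun y hy => ?_) ?_⟩
      · rw [Finset.mem_inter, h1, h2] at hy
        rcases hmeet 0 (ℓ - 1) (by omega) (by omega) y hy.2 hy.1 with h | h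
        · omega
        · simp [h.2.2]
      · rw [Finset.singleton_subset_iff, Finset.mem_inter, h1, h2]
        exact ⟨hv0, hv _ (by omega)⟩
  have hdis : ∀ i j : ZMod ℓ, j ≠ i → j ≠ i + 1 → i ≠ j + 1 → Disjoint (A i) (A j) := by
    intro i j h1 h2 h3
    rw [Finset.disjoint_iff_inter_eq_empty, hAA _ _ h1.symm, Finset.eq_empty_iff_forall_notMem]
    intro y hy
    rw [Finset.mem_inter] at hy
    have hi := i.val_lt
    have hj := j.val_lt
    have h1 := hval _ _ h1
    have h2 := hval _ _ h2
    have h3 := hval _ _ h3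
    have hi' := hsucc i
    have hj' := hsucc j
    rcases Nat.lt_or_gt_of_ne h1 with h | h
    · have := hmeet _ _ h hi y hy.2 hy.1
      omega
    · have := hmeet _ _ h hj y hy.1 hy.2
      omega
  refine ⟨A, ⟨fun i j hij => ?_, fun i => hk _ (hA i), hone, hdis⟩, hA⟩
  by_contra hne'
  have hc := hk _ (hA i)
  by_cases h2 : j = i + 1
  · have := hone i
    rw [← h2, ← hij, Finset.inter_self] at this
    omega
  by_cases h3 : i = j + 1
  · have := hone j
    rw [← h3, ← hij, Finset.inter_self] at this
    omega
  have := hdis i j (Ne.symm hne') h2 h3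
  rw [← hij, disjoint_self, Finset.bot_eq_empty] at this
  rw [this] at hc
  simp at hc
  omega

theorem exists_linearCycle_of_pairs (hk : ∀ e ∈ H, e.card = k) (hk2 : 2 ≤ k) (hℓ : 3 ≤ ℓ)
    (hs : 2 * k * ℓ ≤ s) (v : ℕ → Fin n) (hinj : ∀ i < ℓ, ∀ j < ℓ, v i = v j → i = j)
    (hv : ∀ i, i + 1 < ℓ → IsKernel H s {v i, v (i + 1)})
    (hv0 : IsKernel H s {v (ℓ - 1), v 0}) :
    ∃ A : ZMod ℓ → Finset (Fin n), IsLinearCycle k ℓ A ∧ ∀ i, A i ∈ H := by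
  have hlast : ℓ - 1 + 1 = ℓ := by omega
  refine exists_linearCycle_of_kernels hk hk2 hℓ hs v
    (fun i => {v i, v (if i + 1 = ℓ then 0 else i + 1)}) (fun i hi => ?_) (by simp)
    (fun i hi => ?_) (by simp [hlast]) ?_
  · split_ifs with h
    · obtain rfl : i = ℓ - 1 := by omega
      exact hv0
    · exact hv i (by omega)
  · simp [show i + 1 ≠ ℓ by omega]
  · intro i j hij hj y hyi hyj
    have hi : i + 1 ≠ ℓ := by omega
    simp only [hi, if_false, Finset.mem_insert, Finset.mem_singleton] at hyi
    simp only [Finset.mem_insert, Finset.mem_singleton] at hyj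
    have e1 := fun a b (ha : a < ℓ) (hb : b < ℓ) (ea : y = v a) (eb : y = v b) =>
      hinj a ha b hb (ea.symm.trans eb)
    split_ifs at hyj with h
    · rcases hyi with hyi | hyi <;> rcases hyj with hyj | hyj
      · have := e1 _ _ (by omega) (by omega) hyi hyj; omega
      · have := e1 _ _ (by omega) (by omega) hyi hyj
        exact Or.inr ⟨this, by omega, hyj⟩
      · have := e1 _ _ (by omega) (by omega) hyi hyj
        exact Or.inl ⟨by omega, hyj⟩
      · have := e1 _ _ (by omega) (by omega) hyi hyj; omega
    · rcases hyi with hyi | hyi <;> rcases hyj with hyj | hyj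
      · have := e1 _ _ (by omega) (by omega) hyi hyj; omega
      · have := e1 _ _ (by omega) (by omega) hyi hyj; omega
      · have := e1 _ _ (by omega) (by omega) hyi hyj
        exact Or.inl ⟨by omega, hyj⟩
      · have := e1 _ _ (by omega) (by omega) hyi hyj; omega

end Cycle

section Alternating

/-- The sequence `y 0, d 0, y 1, d 1, …`. -/
def alternate {α : Type*} (y d : ℕ → α) (m : ℕ) : α := if m % 2 = 0 then y (m / 2) else d (m / 2)

theorem alternate_even {α : Type*} (y d : ℕ → α) (i : ℕ) : alternate y d (2 * i) = y i := by
  simp [alternate]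

theorem alternate_odd {α : Type*} (y d : ℕ → α) (i : ℕ) : alternate y d (2 * i + 1) = d i := by
  have h1 : (2 * i + 1) % 2 = 1 := by omega
  have h2 : (2 * i + 1) / 2 = i := by omega
  simp [alternate, h1, h2]

theorem alternate_injOn {α : Type*} {y d : ℕ → α} {t : ℕ}
    (hy : ∀ i ≤ t, ∀ j ≤ t, y i = y j → i = j) (hd : ∀ i ≤ t, ∀ j ≤ t, d i = d j → i = j)
    (hyd : ∀ i ≤ t, ∀ j ≤ t, y i ≠ d j) :
    ∀ i < 2 * t + 2, ∀ j < 2 * t + 2, alternate y d i = alternate y d j → i = j := by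
  intro i hi j hj hij
  rcases Nat.even_or_odd' i with ⟨a, rfl | rfl⟩ <;> rcases Nat.even_or_odd' j with ⟨b, rfl | rfl⟩ <;>
    simp only [alternate_even, alternate_odd] at hij
  · have := hy a (by omega) b (by omega) hij; omega
  · exact absurd hij (hyd a (by omega) b (by omega))
  · exact absurd hij.symm (hyd b (by omega) a (by omega))
  · have := hd a (by omega) b (by omega) hij; omega

variable {n k s t : ℕ} {H : Finset (Finset (Fin n))}

theorem exists_linearCycle_of_alternate (hk : ∀ e ∈ H, e.card = k) (hk2 : 2 ≤ k) (ht : 1 ≤ t)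
    (hs : 2 * k * (2 * t + 2) ≤ s) (y d : ℕ → Fin n)
    (hy : ∀ i ≤ t, ∀ j ≤ t, y i = y j → i = j) (hd : ∀ i ≤ t, ∀ j ≤ t, d i = d j → i = j)
    (hyd : ∀ i ≤ t, ∀ j ≤ t, y i ≠ d j)
    (h1 : ∀ i ≤ t, IsKernel H s {y i, d i}) (h2 : ∀ i < t, IsKernel H s {y (i + 1), d i})
    (h3 : IsKernel H s {y 0, d t}) :
    ∃ A : ZMod (2 * t + 2) → Finset (Fin n), IsLinearCycle k (2 * t + 2) A ∧ ∀ i, A i ∈ H := by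
  refine exists_linearCycle_of_pairs hk hk2 (by omega) hs (alternate y d)
    (alternate_injOn hy hd hyd) (fun i hi => ?_) ?_
  · rcases Nat.even_or_odd' i with ⟨a, rfl | rfl⟩
    · rw [alternate_even, alternate_odd]
      exact h1 a (by omega)
    · rw [alternate_odd, show 2 * a + 1 + 1 = 2 * (a + 1) by ring, alternate_even, Finset.pair_comm]
      exact h2 a (by omega)
  · have e0 := alternate_even y d 0
    rw [show 2 * t + 2 - 1 = 2 * t + 1 by omega, alternate_odd, Finset.pair_comm]
    rw [mul_zero] at e0
    rwa [e0]

/-- A set `X` of `t` points, any two of which have many common neighbours, together with another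
point `x` that shares two neighbours with all points of `X`, yields a cycle of length `2t+2`. -/
theorem exists_linearCycle_of_rich_pairs (hk : ∀ e ∈ H, e.card = k) (hk2 : 2 ≤ k) (ht : 1 ≤ t)
    (hs : 2 * k * (2 * t + 2) ≤ s) (X : Finset (Fin n)) (hX : X.card = t)
    (hrich : ∀ x ∈ X, ∀ x' ∈ X, x ≠ x' → 2 * t + 3 ≤
      (Finset.univ.filter fun b => IsKernel H s {x, b} ∧ IsKernel H s {x', b}).card)
    (x b b' : Fin n) (hx : x ∉ X) (hbb : b ≠ b') (hbX : b ∉ X) (hbX' : b' ∉ X) (hxb : x ≠ b)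
    (hxb' : x ≠ b') (hK : ∀ y ∈ insert x X, IsKernel H s {y, b})
    (hK' : ∀ y ∈ insert x X, IsKernel H s {y, b'}) :
    ∃ A : ZMod (2 * t + 2) → Finset (Fin n), IsLinearCycle k (2 * t + 2) A ∧ ∀ i, A i ∈ H := by
  have : Nonempty (Fin n) := ⟨x⟩
  obtain ⟨p, hp, hpX⟩ := exists_injOn_choice (m := t) (fun _ => X) ∅ (by simp [hX])
  obtain ⟨c, hc, hcN⟩ := exists_injOn_choice (m := t - 1)
    (fun i => Finset.univ.filter fun b => IsKernel H s {p i, b} ∧ IsKernel H s {p (i + 1), b})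
    (insert x (insert b (insert b' X))) (fun i hi => by
      have h1 := hrich (p i) (hpX i (by omega)).1 (p (i + 1)) (hpX _ (by omega)).1 (fun h => by
        have := hp i (by omega) (i + 1) (by omega) h
        omega)
      have h2 : (insert x (insert b (insert b' X))).card ≤ t + 3 := by
        refine (Finset.card_insert_le _ _).trans ?_
        have := Finset.card_insert_le b (insert b' X)
        have := Finset.card_insert_le b' X
        omega
      omega)
  simp only [Finset.mem_filter, Finset.mem_univ, true_and, Finset.mem_insert, not_or] at hcN
  have hpX' : ∀ i < t, p i ∈ X := fun i hi => (hpX i hi).1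
  obtain ⟨r, rfl⟩ : ∃ r, t = r + 1 := ⟨t - 1, by omega⟩
  set y : ℕ → Fin n := fun i => if i = 0 then x else p (i - 1) with hydef
  set d : ℕ → Fin n := fun i => if i = 0 then b else if i = r + 1 then b' else c (i - 1) with hddef
  have hy : ∀ i ≤ r + 1, (i = 0 ∧ y i = x) ∨ ∃ j ≤ r, i = j + 1 ∧ y i = p j := by
    intro i hi
    rcases Nat.eq_zero_or_pos i with rfl | h
    · exact Or.inl ⟨rfl, by simp [hydef]⟩
    · exact Or.inr ⟨i - 1, by omega, by omega, by simp [hydef, h.ne']⟩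
  have hd : ∀ i ≤ r + 1, (i = 0 ∧ d i = b) ∨ (i = r + 1 ∧ d i = b') ∨
      ∃ j < r, i = j + 1 ∧ d i = c j := by
    intro i hi
    rcases Nat.eq_zero_or_pos i with rfl | h
    · exact Or.inl ⟨rfl, by simp [hddef]⟩
    · by_cases h' : i = r + 1
      · exact Or.inr (Or.inl ⟨h', by simp [hddef, h']⟩)
      · exact Or.inr (Or.inr ⟨i - 1, by omega, by omega, by simp [hddef, h.ne', h']⟩)
  have hpx : ∀ j ≤ r, p j ≠ x := fun j hj h => hx (h ▸ hpX' j (by omega))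
  have hpb : ∀ j ≤ r, p j ≠ b := fun j hj h => hbX (h ▸ hpX' j (by omega))
  have hpb' : ∀ j ≤ r, p j ≠ b' := fun j hj h => hbX' (h ▸ hpX' j (by omega))
  refine exists_linearCycle_of_alternate hk hk2 ht hs y d ?_ ?_ ?_ ?_ ?_ ?_
  · intro i hi j hj hij
    rcases hy i hi with ⟨h1, h2⟩ | ⟨i', h0, h1, h2⟩ <;>
      rcases hy j hj with ⟨h3, h4⟩ | ⟨j', h5, h3, h4⟩ <;> rw [h2, h4] at hij
    · omega
    · exact absurd hij.symm (hpx _ h5)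
    · exact absurd hij (hpx _ h0)
    · have := hp i' (by omega) j' (by omega) hij
      omega
  · intro i hi j hj hij
    rcases hd i hi with ⟨h1, h2⟩ | ⟨h1, h2⟩ | ⟨i', h0, h1, h2⟩ <;>
      rcases hd j hj with ⟨h3, h4⟩ | ⟨h3, h4⟩ | ⟨j', h5, h3, h4⟩ <;> rw [h2, h4] at hij
    · omega
    · exact absurd hij hbb
    · exact absurd hij.symm (hcN j' (by omega)).2.2.1
    · exact absurd hij.symm hbb
    · omega
    · exact absurd hij.symm (hcN j' (by omega)).2.2.2.1
    · exact absurd hij (hcN i' (by omega)).2.2.1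
    · exact absurd hij (hcN i' (by omega)).2.2.2.1
    · have := hc i' (by omega) j' (by omega) hij
      omega
  · intro i hi j hj
    rcases hy i hi with ⟨h1, h2⟩ | ⟨i', h0, h1, h2⟩ <;>
      rcases hd j hj with ⟨h3, h4⟩ | ⟨h3, h4⟩ | ⟨j', h5, h3, h4⟩ <;> rw [h2, h4]
    · exact hxb
    · exact hxb'
    · exact fun h => (hcN j' (by omega)).2.1 h.symm
    · exact hpb _ h0
    · exact hpb' _ h0
    · intro h
      exact (hcN j' (by omega)).2.2.2.2 (h ▸ hpX' i' (by omega))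
  · intro i hi
    rcases hd i hi with ⟨h3, h4⟩ | ⟨h3, h4⟩ | ⟨j', h5, h3, h4⟩ <;> rw [h4]
    · exact hK _ (by simp [hydef, h3])
    · exact hK' _ (by simpa [hydef, h3] using Or.inr (hpX' r (by omega)))
    · simpa [hydef, h3] using (hcN j' (by omega)).1.1
  · intro i hi
    rcases hd i hi.le with ⟨h3, h4⟩ | ⟨h3, h4⟩ | ⟨j', h5, h3, h4⟩ <;> rw [h4]
    · exact hK _ (by simpa [hydef, h3] using Or.inr (hpX' 0 (by omega)))
    · omega
    · simpa [hydef, h3] using (hcN j' (by omega)).1.2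
  · have : d (r + 1) = b' := by simp [hddef]
    rw [this]
    exact hK' _ (by simp [hydef])

/-- Two edges meeting in one point are closed up to a cycle of length `2t+2` by a set `T` of `t`
points that are joined to all points of a large set `W`. -/
theorem exists_linearCycle_of_two_edges (hk : ∀ e ∈ H, e.card = k) (hk2 : 2 ≤ k) (ht : 1 ≤ t)
    (hs : 2 * k * (2 * t + 2) ≤ s) (T W : Finset (Fin n)) (hT : T.card = t)
    (hTW : ∀ x ∈ T, ∀ w ∈ W, IsKernel H s {w, x}) (hW : 2 * t + 1 + 2 * k ≤ W.card)
    {e f : Finset (Fin n)} (he : e ∈ H) (hf : f ∈ H) (heT : Disjoint e T) (hfT : Disjoint f T)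
    {u v z : Fin n} (hef : e ∩ f = {z}) (hu : u ∈ e) (huf : u ∉ f) (huW : u ∈ W)
    (hv : v ∈ f) (hve : v ∉ e) (hvW : v ∈ W) :
    ∃ A : ZMod (2 * t + 2) → Finset (Fin n), IsLinearCycle k (2 * t + 2) A ∧ ∀ i, A i ∈ H := by
  have : Nonempty (Fin n) := ⟨u⟩
  obtain ⟨p, hp, hpT⟩ := exists_injOn_choice (m := t) (fun _ => T) ∅ (by simp [hT])
  obtain ⟨c, hc, hcW⟩ := exists_injOn_choice (m := t + 1) (fun _ => W) (e ∪ f ∪ T) (fun i hi => by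
    have h1 := Finset.card_union_le (e ∪ f) T
    have h2 := Finset.card_union_le e f
    have h3 := hk e he
    have h4 := hk f hf
    omega)
  simp only [Finset.mem_union, not_or] at hcW
  have hpT' : ∀ i < t, p i ∈ T := fun i hi => (hpT i hi).1
  rw [Finset.disjoint_left] at heT hfT
  have hz : z ∈ e ∧ z ∈ f := by
    rw [← Finset.mem_inter, hef]; simp
  have hzef : ∀ y, y ∈ e → y ∈ f → y = z := fun y h1 h2 => by
    rw [← Finset.mem_singleton, ← hef]; exact Finset.mem_inter.2 ⟨h1, h2⟩
  set y : ℕ → Fin n := fun i => if i = 0 then u else if i = 1 then v else c i with hydef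
  set d : ℕ → Fin n := fun i => if i = 0 then z else p (i - 1) with hddef
  have y0 : y 0 = u := by simp [hydef]
  have y1 : y 1 = v := by simp [hydef]
  have d0 : d 0 = z := by simp [hddef]
  have hd1 : ∀ i, 1 ≤ i → i ≤ t → d i ∈ T := fun i h1 h2 => by
    simpa [hddef, show i ≠ 0 by omega] using hpT' (i - 1) (by omega)
  have hy2 : ∀ i, 2 ≤ i → i ≤ t → y i = c i := fun i h1 h2 => by
    simp [hydef, show i ≠ 0 by omega, show i ≠ 1 by omega]
  have hyW : ∀ i ≤ t, y i ∈ W := by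
    intro i hi
    rcases (show i = 0 ∨ i = 1 ∨ 2 ≤ i by omega) with rfl | rfl | h
    · rwa [y0]
    · rwa [y1]
    · rw [hy2 i h hi]; exact (hcW i (by omega)).1
  have hyT : ∀ i ≤ t, y i ∉ T := by
    intro i hi
    rcases (show i = 0 ∨ i = 1 ∨ 2 ≤ i by omega) with rfl | rfl | h
    · rw [y0]; exact heT hu
    · rw [y1]; exact hfT hv
    · rw [hy2 i h hi]; exact (hcW i (by omega)).2.2
  have hy : ∀ i ≤ t, ∀ j ≤ t, y i = y j → i = j := by
    have aux : ∀ i ≤ t, ∀ j ≤ t, i < j → y i ≠ y j := by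
      intro i hi j hj hij h
      rcases (show j = 1 ∨ 2 ≤ j by omega) with rfl | h2
      · obtain rfl : i = 0 := by omega
        rw [y0, y1] at h
        exact hve (h ▸ hu)
      · have hcj := hcW j (by omega)
        rw [hy2 j h2 hj] at h
        rcases (show i = 0 ∨ i = 1 ∨ 2 ≤ i by omega) with rfl | rfl | h'
        · exact hcj.2.1.1 (by rw [← h, y0]; exact hu)
        · exact hcj.2.1.2 (by rw [← h, y1]; exact hv)
        · rw [hy2 i h' hi] at h
          have := hc i (by omega) j (by omega) h
          omega
    intro i hi j hj h
    rcases lt_trichotomy i j with h' | h' | h'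
    · exact absurd h (aux i hi j hj h')
    · exact h'
    · exact absurd h.symm (aux j hj i hi h')
  have hd : ∀ i ≤ t, ∀ j ≤ t, d i = d j → i = j := by
    intro i hi j hj h
    rcases Nat.eq_zero_or_pos i with rfl | hi0 <;> rcases Nat.eq_zero_or_pos j with rfl | hj0
    · rfl
    · rw [d0] at h
      exact absurd (h ▸ hd1 j hj0 hj) (heT hz.1)
    · rw [d0] at h
      exact absurd (h ▸ hd1 i hi0 hi) (heT hz.1)
    · simp only [hddef, show i ≠ 0 by omega, show j ≠ 0 by omega, if_false] at h
      have := hp (i - 1) (by omega) (j - 1) (by omega) h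
      omega
  have hyd : ∀ i ≤ t, ∀ j ≤ t, y i ≠ d j := by
    intro i hi j hj h
    rcases Nat.eq_zero_or_pos j with rfl | hj0
    · rw [d0] at h
      rcases (show i = 0 ∨ i = 1 ∨ 2 ≤ i by omega) with rfl | rfl | h2
      · exact huf (by rw [← y0, h]; exact hz.2)
      · exact hve (by rw [← y1, h]; exact hz.1)
      · exact (hcW i (by omega)).2.1.1 (by rw [← hy2 i h2 hi, h]; exact hz.1)
    · exact hyT i hi (h ▸ hd1 j hj0 hj)
  have hinj := alternate_injOn hy hd hyd
  have hKyd : ∀ i ≤ t, ∀ j, 1 ≤ j → j ≤ t → IsKernel H s {y i, d j} := fun i hi j h1 h2 =>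
    hTW _ (hd1 j h1 h2) _ (hyW i hi)
  set w := alternate y d with hw
  have w0 : w 0 = u := (alternate_even y d 0).trans y0
  have w1 : w 1 = z := (alternate_odd y d 0).trans d0
  have w2 : w 2 = v := (alternate_even y d 1).trans y1
  have hwe : ∀ i < 2 * t + 2, w i ∈ e → i = 0 ∨ i = 1 := by
    intro i hi h
    by_contra! h'
    rcases Nat.even_or_odd' i with ⟨a, rfl | rfl⟩
    · rw [hw, alternate_even] at h
      rcases (show a = 1 ∨ 2 ≤ a by omega) with rfl | h2
      · exact hve (y1 ▸ h)
      · exact (hcW a (by omega)).2.1.1 (hy2 a h2 (by omega) ▸ h)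
    · rw [hw, alternate_odd] at h
      exact heT h (hd1 a (by omega) (by omega))
  have hwf : ∀ i < 2 * t + 2, w i ∈ f → i = 1 ∨ i = 2 := by
    intro i hi h
    by_contra! h'
    rcases Nat.even_or_odd' i with ⟨a, rfl | rfl⟩
    · rw [hw, alternate_even] at h
      rcases (show a = 0 ∨ 2 ≤ a by omega) with rfl | h2
      · exact huf (y0 ▸ h)
      · exact (hcW a (by omega)).2.1.2 (hy2 a h2 (by omega) ▸ h)
    · rw [hw, alternate_odd] at h
      exact hfT h (hd1 a (by omega) (by omega))
  set S : ℕ → Finset (Fin n) := fun i => if i = 0 then e else if i = 1 then f else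
    {w i, w (if i + 1 = 2 * t + 2 then 0 else i + 1)} with hSdef
  have S0 : S 0 = e := by simp [hSdef]
  have S1 : S 1 = f := by simp [hSdef]
  have S2 : ∀ i, 2 ≤ i → S i = {w i, w (if i + 1 = 2 * t + 2 then 0 else i + 1)} := fun i hi => by
    simp [hSdef, show i ≠ 0 by omega, show i ≠ 1 by omega]
  refine exists_linearCycle_of_kernels hk hk2 (by omega) hs w S ?_ ?_ ?_ ?_ ?_
  · intro i hi
    rcases (show i = 0 ∨ i = 1 ∨ 2 ≤ i by omega) with rfl | rfl | h2
    · rw [S0]; exact isKernel_of_mem he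
    · rw [S1]; exact isKernel_of_mem hf
    · rw [S2 i h2]
      rcases Nat.even_or_odd' i with ⟨a, rfl | rfl⟩
      · rw [if_neg (by omega), hw, alternate_even, alternate_odd]
        exact hKyd a (by omega) a (by omega) (by omega)
      · rw [Finset.pair_comm]
        split_ifs with h
        · rw [w0, hw, alternate_odd, ← y0]
          exact hKyd 0 (by omega) a (by omega) (by omega)
        · rw [hw, alternate_odd, show 2 * a + 1 + 1 = 2 * (a + 1) by ring, alternate_even]
          exact hKyd (a + 1) (by omega) a (by omega) (by omega)
  · intro i hi
    rcases (show i = 0 ∨ i = 1 ∨ 2 ≤ i by omega) with rfl | rfl | h2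
    · rwa [S0, w0]
    · rw [S1, w1]; exact hz.2
    · simp [S2 i h2]
  · intro i hi
    rcases (show i = 0 ∨ i = 1 ∨ 2 ≤ i by omega) with rfl | rfl | h2
    · rw [S0, zero_add, w1]; exact hz.1
    · rwa [S1, w2]
    · rw [S2 i h2, if_neg (by omega)]; simp
  · rw [S2 _ (by omega), if_pos (by omega)]; simp
  · intro i j hij hj a hai haj
    have e1 := fun i j (hi : i < 2 * t + 2) (hj : j < 2 * t + 2) (ei : a = w i) (ej : a = w j) =>
      hinj i hi j hj (ei.symm.trans ej)
    have mem2 : ∀ i, 2 ≤ i → i < 2 * t + 2 → a ∈ S i → a = w i ∨ (i + 1 < 2 * t + 2 ∧ a = w (i + 1)) ∨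
        (i = 2 * t + 1 ∧ a = w 0) := by
      intro i h2 hi h
      rw [S2 i h2, Finset.mem_insert, Finset.mem_singleton] at h
      split_ifs at h with h'
      · exact h.imp_right fun h => Or.inr ⟨by omega, h⟩
      · exact h.imp_right fun h => Or.inl ⟨by omega, h⟩
    rcases (show j = 1 ∨ 2 ≤ j by omega) with rfl | h2
    · obtain rfl : i = 0 := by omega
      rw [S0] at hai
      rw [S1] at haj
      exact Or.inl ⟨rfl, by rw [w1]; exact hzef a hai haj⟩
    · have haj' := mem2 j h2 hj haj
      rcases (show i = 0 ∨ i = 1 ∨ 2 ≤ i by omega) with rfl | rfl | h3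
      · rw [S0] at hai
        rcases haj' with h | ⟨h', h⟩ | ⟨h', h⟩
        · have := hwe j hj (h ▸ hai); omega
        · have := hwe _ h' (h ▸ hai); omega
        · exact Or.inr ⟨rfl, by omega, h⟩
      · rw [S1] at hai
        rcases haj' with h | ⟨h', h⟩ | ⟨h', h⟩
        · have := hwf j hj (h ▸ hai)
          exact Or.inl ⟨by omega, h⟩
        · have := hwf _ h' (h ▸ hai); omega
        · have := hwf 0 (by omega) (h ▸ hai); omega
      · have hai' := mem2 i h3 (by omega) hai
        rcases hai' with h | ⟨h', h⟩ | ⟨h', h⟩ <;> rcases haj' with g | ⟨g', g⟩ | ⟨g', g⟩ <;>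
          have hh := e1 _ _ (by omega) (by omega) h g
        · omega
        · omega
        · omega
        · exact Or.inl ⟨by omega, g⟩
        · omega
        · omega
        · omega
        · omega
        · omega

end Alternating

section Homogeneous

variable {α : Type*} {k s : ℕ}

/-- The restriction of `f` to `σ` is an `s`-kernel of the family `N` of maps: for every set `U` of
at most `s` points, some member of `N` agrees with `f` on `σ` and avoids `U` outside of `σ`. -/
def IsMapKernel (N : Finset (Fin k → α)) (s : ℕ) (f : Fin k → α) (σ : Finset (Fin k)) : Prop :=
  ∀ U : Finset α, U.card ≤ s → ∃ g ∈ N, (∀ p ∈ σ, g p = f p) ∧ ∀ p ∉ σ, g p ∉ U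

theorem IsMapKernel.mono {N N' : Finset (Fin k → α)} {f : Fin k → α} {σ : Finset (Fin k)}
    (h : IsMapKernel N s f σ) (hN : N ⊆ N') : IsMapKernel N' s f σ := fun U hU => by
  obtain ⟨g, hg, h'⟩ := h U hU
  exact ⟨g, hN hg, h'⟩

theorem IsMapKernel.congr {N : Finset (Fin k → α)} {f f' : Fin k → α} {σ : Finset (Fin k)}
    (h : IsMapKernel N s f σ) (hf : ∀ p ∈ σ, f p = f' p) : IsMapKernel N s f' σ := fun U hU => by
  obtain ⟨g, hg, h1, h2⟩ := h U hU
  exact ⟨g, hg, fun p hp => (h1 p hp).trans (hf p hp), h2⟩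

variable [DecidableEq α]

theorem exists_split_isMapKernel (s : ℕ) (J : Finset (Finset (Fin k))) (N : Finset (Fin k → α)) :
    ∃ G ⊆ N, ∃ P : Finset (Fin k) → Finset (Fin k → α),
      (∀ σ ∈ J, P σ ⊆ N ∧ ∀ f ∈ P σ, ¬ IsMapKernel (P σ) s f σ) ∧
      (∀ f ∈ G, ∀ σ ∈ J, IsMapKernel G s f σ) ∧ N.card ≤ G.card + ∑ σ ∈ J, (P σ).card := by
  induction N using Finset.strongInduction with
  | H N ih =>
    by_cases hN : ∀ f ∈ N, ∀ σ ∈ J, IsMapKernel N s f σ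
    · exact ⟨N, subset_rfl, fun _ => ∅, by simp, hN, by simp⟩
    push Not at hN
    obtain ⟨f₀, hf₀, σ₀, hσ₀, hnot⟩ := hN
    set A := N.filter fun f => ∀ p ∈ σ₀, f p = f₀ p with hA
    set N' := N.filter fun f => ¬ ∀ p ∈ σ₀, f p = f₀ p with hN'
    have hcard : A.card + N'.card = N.card := Finset.card_filter_add_card_filter_not _
    have hsub : N' ⊂ N := by
      refine Finset.filter_ssubset.2 ⟨f₀, hf₀, by simp⟩
    obtain ⟨G, hG, P, hP, hGJ, hc⟩ := ih N' hsub
    refine ⟨G, hG.trans hsub.1, Function.update P σ₀ (P σ₀ ∪ A), fun σ hσ => ?_, hGJ, ?_⟩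
    · by_cases h : σ = σ₀
      · subst h
        rw [Function.update_self]
        obtain ⟨h1, h2⟩ := hP σ hσ
        refine ⟨Finset.union_subset (h1.trans hsub.1) (Finset.filter_subset _ _), fun f hf hker => ?_⟩
        have hsubN : P σ ∪ A ⊆ N :=
          Finset.union_subset (h1.trans hsub.1) (Finset.filter_subset _ _)
        by_cases hfA : ∀ p ∈ σ, f p = f₀ p
        · exact hnot ((hker.mono hsubN).congr hfA)
        · have hfP : f ∈ P σ := by
            rcases Finset.mem_union.1 hf with h | h
            · exact h
            · exact absurd (Finset.mem_filter.1 h).2 hfA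
          refine h2 f hfP fun U hU => ?_
          obtain ⟨g, hg, hgf, hgU⟩ := hker U hU
          refine ⟨g, (Finset.mem_union.1 hg).resolve_right fun hgA => hfA fun p hp => ?_, hgf, hgU⟩
          rw [← hgf p hp]
          exact (Finset.mem_filter.1 hgA).2 p hp
      · rw [Function.update_of_ne h]
        exact ⟨(hP σ hσ).1.trans hsub.1, (hP σ hσ).2⟩
    · have hsum : ∑ σ ∈ J, (Function.update P σ₀ (P σ₀ ∪ A) σ).card ≥
          ∑ σ ∈ J, (P σ).card + A.card := by
        rw [← Finset.add_sum_erase _ _ hσ₀, ← Finset.add_sum_erase _ _ hσ₀, Function.update_self]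
        have hd : Disjoint (P σ₀) A := by
          rw [Finset.disjoint_left]
          intro f hf hfA
          exact (Finset.mem_filter.1 ((hP σ₀ hσ₀).1 hf)).2 (Finset.mem_filter.1 hfA).2
        rw [Finset.card_union_of_disjoint hd]
        have : ∑ σ ∈ J.erase σ₀, (Function.update P σ₀ (P σ₀ ∪ A) σ).card =
            ∑ σ ∈ J.erase σ₀, (P σ).card := Finset.sum_congr rfl fun σ hσ => by
          rw [Function.update_of_ne (Finset.ne_of_mem_erase hσ)]
        omega
      omega

theorem exists_homogeneous_subfamily (s : ℕ) (J₀ : Finset (Finset (Fin k))) :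
    ∀ N : Finset (Fin k → α), (∀ f ∈ N, ∀ σ, IsMapKernel N s f σ → σ ∈ J₀) →
    ∃ G ⊆ N, ∃ J : Finset (Finset (Fin k)), N.card ≤ (2 ^ k + 1) ^ J₀.card * G.card ∧
      ∀ f ∈ G, ∀ σ, IsMapKernel G s f σ ↔ σ ∈ J := by
  induction J₀ using Finset.strongInduction with
  | H J₀ ih =>
    intro N hN
    obtain ⟨G, hG, P, hP, hGJ, hc⟩ := exists_split_isMapKernel s J₀ N
    have hJ₀ : J₀.card ≤ 2 ^ k := by
      refine (Finset.card_le_univ J₀).trans ?_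
      simp
    by_cases hGc : N.card ≤ (2 ^ k + 1) * G.card
    · rcases Nat.eq_zero_or_pos J₀.card with h0 | hpos
      · refine ⟨N, subset_rfl, J₀, by simp [h0], fun f hf σ => ⟨hN f hf σ, fun h => ?_⟩⟩
        rw [Finset.card_eq_zero.1 h0] at h
        simp at h
      · refine ⟨G, hG, J₀, hGc.trans ?_, fun f hf σ =>
          ⟨fun h => hN f (hG hf) σ (h.mono hG), hGJ f hf σ⟩⟩
        exact Nat.mul_le_mul_right _ (Nat.le_self_pow hpos.ne' _)
    · have : ∃ σ ∈ J₀, N.card ≤ (2 ^ k + 1) * (P σ).card := by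
        by_contra! hcon
        have h1 : ∑ σ ∈ J₀, (2 ^ k + 1) * (P σ).card ≤ ∑ σ ∈ J₀, N.card :=
          Finset.sum_le_sum fun σ hσ => (hcon σ hσ).le
        rw [← Finset.mul_sum, Finset.sum_const, smul_eq_mul] at h1
        have h2 : J₀.card * N.card ≤ 2 ^ k * N.card := Nat.mul_le_mul_right _ hJ₀
        have h3 := Nat.mul_le_mul_left (2 ^ k + 1) hc
        push Not at hGc
        rw [Nat.mul_add] at h3
        have h4 : (2 ^ k + 1) * N.card = 2 ^ k * N.card + N.card := by ring
        omega
      obtain ⟨σ, hσ, hPc⟩ := this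
      obtain ⟨h1, h2⟩ := hP σ hσ
      obtain ⟨G', hG', J, hc', hJ⟩ := ih (J₀.erase σ) (Finset.erase_ssubset hσ) (P σ)
        fun f hf τ hτ => Finset.mem_erase.2
          ⟨fun h => h2 f hf (h ▸ hτ), hN f (h1 hf) τ (hτ.mono h1)⟩
      refine ⟨G', hG'.trans h1, J, ?_, hJ⟩
      calc N.card ≤ (2 ^ k + 1) * (P σ).card := hPc
        _ ≤ (2 ^ k + 1) * ((2 ^ k + 1) ^ (J₀.erase σ).card * G'.card) := Nat.mul_le_mul_left _ hc'
        _ = (2 ^ k + 1) ^ J₀.card * G'.card := by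
          rw [← mul_assoc, ← pow_succ', Finset.card_erase_add_one hσ]

theorem exists_isMapKernel_of_card_lt (m : ℕ) : ∀ (F : Finset (Fin k → α)) (σ : Finset (Fin k)),
    k ≤ σ.card + m → (∀ f ∈ F, ∀ g ∈ F, ∀ p ∈ σ, f p = g p) → (k * s + 1) ^ m < F.card →
    ∃ τ, σ ⊆ τ ∧ τ ≠ Finset.univ ∧ ∃ f ∈ F, IsMapKernel F s f τ := by
  induction m with
  | zero =>
    intro F σ hσ hF hc
    have hσ' : σ = Finset.univ := by
      rw [← Finset.card_eq_iff_eq_univ, Fintype.card_fin]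
      have := Finset.card_le_univ σ
      rw [Fintype.card_fin] at this
      omega
    rw [pow_zero, Finset.one_lt_card] at hc
    obtain ⟨f, hf, g, hg, hfg⟩ := hc
    exact absurd (funext fun p => hF f hf g hg p (by simp [hσ'])) hfg
  | succ m ih =>
    intro F σ hσ hF hc
    obtain ⟨f, hf⟩ : F.Nonempty := Finset.card_pos.1 (by omega)
    have hσ' : σ ≠ Finset.univ := by
      rintro rfl
      have : F.card ≤ 1 := Finset.card_le_one.2 fun f hf g hg =>
        funext fun p => hF f hf g hg p (by simp)
      have := Nat.one_le_pow (m + 1) (k * s + 1) (by omega)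
      omega
    by_cases hker : IsMapKernel F s f σ
    · exact ⟨σ, subset_rfl, hσ', f, hf, hker⟩
    simp only [IsMapKernel, not_forall, not_exists, not_and] at hker
    obtain ⟨U, hU, hker⟩ := hker
    have hcov : F ⊆ (σᶜ ×ˢ U).biUnion fun q => F.filter fun g => g q.1 = q.2 := by
      intro g hg
      obtain ⟨p, hp, hpU⟩ := hker g hg fun p hp => hF g hg f hf p hp
      rw [Finset.mem_biUnion]
      exact ⟨(p, g p), by simpa using ⟨hp, not_not.1 hpU⟩, by simpa using hg⟩
    have : ∃ q ∈ σᶜ ×ˢ U, (k * s + 1) ^ m < (F.filter fun g => g q.1 = q.2).card := by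
      by_contra! hcon
      have h1 := (Finset.card_le_card hcov).trans (Finset.card_biUnion_le_card_mul _ _ _ hcon)
      have h2 : (σᶜ ×ˢ U).card ≤ k * s := by
        rw [Finset.card_product]
        refine Nat.mul_le_mul ?_ hU
        simpa using Finset.card_le_univ σᶜ
      have h3 : (σᶜ ×ˢ U).card * (k * s + 1) ^ m ≤ (k * s + 1) * (k * s + 1) ^ m :=
        Nat.mul_le_mul_right _ (by omega)
      rw [pow_succ'] at hc
      omega
    obtain ⟨⟨p, u⟩, hq, hlt⟩ := this
    have hp : p ∉ σ := by simpa using (Finset.mem_product.1 hq).1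
    obtain ⟨τ, h1, h2, g, hg, h3⟩ := ih (F.filter fun g => g p = u) (insert p σ)
      (by rw [Finset.card_insert_of_notMem hp]; omega) (fun f hf g hg q hq => by
        rw [Finset.mem_filter] at hf hg
        rcases Finset.mem_insert.1 hq with rfl | hq
        · rw [hf.2, hg.2]
        · exact hF f hf.1 g hg.1 q hq) hlt
    exact ⟨τ, (Finset.subset_insert _ _).trans h1, h2, g, (Finset.mem_filter.1 hg).1,
      h3.mono (Finset.filter_subset _ _)⟩

theorem card_le_of_uncovered [Fintype α] {G : Finset (Fin k → α)} {J : Finset (Finset (Fin k))}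
    (hJ : ∀ f ∈ G, ∀ σ, IsMapKernel G s f σ → σ ∈ J) (D : Finset (Fin k))
    (hD : ∀ σ ∈ J, D ⊆ σ → σ = Finset.univ) :
    G.card ≤ (k * s + 1) ^ k * Fintype.card α ^ D.card := by
  have h1 := Finset.card_le_mul_card_image (f := fun (f : Fin k → α) (p : D) => f p) G
    ((k * s + 1) ^ k) (fun a _ => by
      by_contra! hlt
      obtain ⟨τ, h1, h2, f, hf, h3⟩ := exists_isMapKernel_of_card_lt (s := s) k _ D (by omega)
        (fun f hf g hg p hp => by
          rw [Finset.mem_filter] at hf hg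
          exact congrFun (hf.2.trans hg.2.symm) ⟨p, hp⟩) hlt
      exact h2 (hD τ (hJ f (Finset.mem_filter.1 hf).1 τ (h3.mono (Finset.filter_subset _ _))) h1))
  refine h1.trans (Nat.mul_le_mul_left _ ((Finset.card_le_univ _).trans ?_))
  simp

/-- Every large `k`-uniform family contains a nonempty homogeneous subfamily, whose members
are enumerated such that they all have the same kernels `J`; if the family has more than
`C * |α| ^ r` members, then every set of `r` positions is contained in a proper member of `J`. -/
theorem exists_homogeneous [Fintype α] (s r : ℕ) (N : Finset (Finset α))
    (hk : ∀ e ∈ N, e.card = k)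
    (hN : (2 ^ k + 1) ^ 2 ^ k * (k * s + 1) ^ k * Fintype.card α ^ r < N.card) :
    ∃ (G : Finset (Fin k → α)) (J : Finset (Finset (Fin k))), G.Nonempty ∧
      (∀ f ∈ G, Function.Injective f ∧ Finset.univ.image f ∈ N) ∧
      (∀ f ∈ G, ∀ σ ∈ J, IsMapKernel G s f σ) ∧ Finset.univ ∈ J ∧
      (∀ σ ∈ J, ∀ τ ∈ J, σ ∩ τ ∈ J) ∧
      ∀ D : Finset (Fin k), D.card = r → ∃ σ ∈ J, D ⊆ σ ∧ σ ≠ Finset.univ := by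
  have henum : ∀ e : Finset α, ∃ f : Fin k → α, e ∈ N →
      Function.Injective f ∧ Finset.univ.image f = e := by
    intro e
    by_cases he : e ∈ N
    · refine ⟨fun p => ((e.equivFinOfCardEq (hk e he)).symm p : α), fun _ => ⟨?_, ?_⟩⟩
      · exact Subtype.val_injective.comp (Equiv.injective _)
      · ext y
        simp only [Finset.mem_image, Finset.mem_univ, true_and]
        constructor
        · rintro ⟨p, rfl⟩
          exact Subtype.property _
        · exact fun hy => ⟨e.equivFinOfCardEq (hk e he) ⟨y, hy⟩, by simp⟩
    · have : k = 0 ∨ Nonempty α := by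
        obtain ⟨e', he'⟩ : N.Nonempty := Finset.card_pos.1 (by omega)
        rcases Nat.eq_zero_or_pos k with h | h
        · exact Or.inl h
        · obtain ⟨a, -⟩ := Finset.card_pos.1 ((hk e' he').symm ▸ h)
          exact Or.inr ⟨a⟩
      rcases this with rfl | ⟨⟨a⟩⟩
      · exact ⟨Fin.elim0, fun h => absurd h he⟩
      · exact ⟨fun _ => a, fun h => absurd h he⟩
  choose φ hφ using henum
  have hinj : Set.InjOn φ N := fun e he e' he' h => by
    rw [← (hφ e he).2, h, (hφ e' he').2]
  obtain ⟨G, hG, J, hc, hJ⟩ := exists_homogeneous_subfamily s Finset.univ (N.image φ) (by simp)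
  rw [Finset.card_image_of_injOn hinj] at hc
  have hc' : N.card ≤ (2 ^ k + 1) ^ 2 ^ k * G.card := by simpa using hc
  have hlt : (k * s + 1) ^ k * Fintype.card α ^ r < G.card := by
    have := hN.trans_le hc'
    rw [mul_assoc] at this
    exact lt_of_mul_lt_mul_left this (Nat.zero_le _)
  obtain ⟨f₀, hf₀⟩ : G.Nonempty := Finset.card_pos.1 (by omega)
  refine ⟨G, J, ⟨f₀, hf₀⟩, fun f hf => ?_, fun f hf σ hσ => (hJ f hf σ).2 hσ, ?_, ?_, ?_⟩
  · obtain ⟨e, he, rfl⟩ := Finset.mem_image.1 (hG hf)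
    exact ⟨(hφ e he).1, (hφ e he).2.symm ▸ he⟩
  · exact (hJ f₀ hf₀ _).1 fun U _ => ⟨f₀, hf₀, by simp, by simp⟩
  · intro σ hσ τ hτ
    refine (hJ f₀ hf₀ _).1 fun U hU => ?_
    obtain ⟨f, hf, h1, h2⟩ := (hJ f₀ hf₀ σ).2 hσ U hU
    obtain ⟨g, hg, h3, h4⟩ := (hJ f hf τ).2 hτ U hU
    refine ⟨g, hg, fun p hp => ?_, fun p hp => ?_⟩
    · rw [Finset.mem_inter] at hp
      rw [h3 p hp.2, h1 p hp.1]
    · by_cases hpτ : p ∈ τ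
      · rw [h3 p hpτ]
        exact h2 p fun h => hp (Finset.mem_inter.2 ⟨h, hpτ⟩)
      · exact h4 p hpτ
  · intro D hD
    by_contra! hcon
    have := card_le_of_uncovered (fun f hf σ h => (hJ f hf σ).1 h) D hcon
    rw [hD] at this
    omega

theorem IsMapKernel.isKernel_image {N : Finset (Finset α)} {G : Finset (Fin k → α)}
    (hG : ∀ f ∈ G, Finset.univ.image f ∈ N) {f : Fin k → α} {σ : Finset (Fin k)}
    (h : IsMapKernel G s f σ) : IsKernel N s (σ.image f) := by
  intro U hU
  obtain ⟨g, hg, h1, h2⟩ := h U hU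
  have hσ : σ.image f = σ.image g := Finset.image_congr fun p hp => (h1 p hp).symm
  refine ⟨_, hG g hg, hσ ▸ Finset.image_subset_image (Finset.subset_univ _), ?_⟩
  rw [Finset.disjoint_left]
  intro y hy
  rw [Finset.mem_sdiff, Finset.mem_image] at hy
  obtain ⟨⟨p, -, rfl⟩, hp⟩ := hy
  exact h2 p fun hpσ => hp (hσ ▸ Finset.mem_image_of_mem g hpσ)

theorem IsKernel.mono {N H : Finset (Finset α)} {S : Finset α} (h : IsKernel N s S) (hNH : N ⊆ H) :
    IsKernel H s S := fun U hU => by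
  obtain ⟨e, he, h'⟩ := h U hU
  exact ⟨e, hNH he, h'⟩

end Homogeneous

section Patterns

variable {k : ℕ} {J : Finset (Finset (Fin k))}

theorem mem_of_forall_separated (huniv : Finset.univ ∈ J) (hinter : ∀ σ ∈ J, ∀ τ ∈ J, σ ∩ τ ∈ J)
    (S : Finset (Fin k)) (hS : ∀ r ∉ S, ∃ G ∈ J, S ⊆ G ∧ r ∉ G) : S ∈ J := by
  have hS' : ∀ r, ∃ G, r ∉ S → G ∈ J ∧ S ⊆ G ∧ r ∉ G := fun r => by
    by_cases h : r ∈ S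
    · exact ⟨∅, fun h' => absurd h h'⟩
    · obtain ⟨G, hG⟩ := hS r h
      exact ⟨G, fun _ => hG⟩
  choose G hG using hS'
  have h1 : S = Sᶜ.inf G := by
    refine Finset.Subset.antisymm (Finset.le_inf fun r hr => (hG r (by simpa using hr)).2.1)
      fun y hy => ?_
    by_contra hyS
    exact (hG y hyS).2.2 ((Finset.inf_le (f := G) (by simpa using hyS) : _ ≤ G y) hy)
  rw [h1]
  exact Finset.inf_induction huniv hinter fun r hr => (hG r (by simpa using hr)).1

/-- An intersection-closed pattern covering all sets of size `k - 2` contains all pairs at some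
point, or all pairs of some triangle. -/
theorem star_or_triangle (hk : 5 ≤ k) (huniv : Finset.univ ∈ J)
    (hinter : ∀ σ ∈ J, ∀ τ ∈ J, σ ∩ τ ∈ J)
    (hcov : ∀ D : Finset (Fin k), D.card = k - 2 → ∃ σ ∈ J, D ⊆ σ ∧ σ ≠ Finset.univ) :
    (∃ p, ∀ q ≠ p, {p, q} ∈ J) ∨
      ∃ p q r : Fin k, p ≠ q ∧ p ≠ r ∧ q ≠ r ∧ {p, q} ∈ J ∧ {p, r} ∈ J ∧ {q, r} ∈ J := by
  set B : Finset (Fin k) := Finset.univ.filter fun a => {a}ᶜ ∉ J with hB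
  have hBmem : ∀ a, a ∈ B ↔ {a}ᶜ ∉ J := by simp [hB]
  have hcompl : ∀ a b : Fin k, a ≠ b → a ∈ B → b ∈ B → ({a, b} : Finset (Fin k))ᶜ ∈ J := by
    intro a b hab ha hb
    obtain ⟨G, hG, hDG, hGu⟩ := hcov ({a, b}ᶜ) (by
      rw [Finset.card_compl, Fintype.card_fin, Finset.card_pair hab])
    have hsub : ∀ x, x ≠ a → x ≠ b → x ∈ G := fun x h1 h2 => hDG (by simp [h1, h2])
    have aux : ∀ a b, (∀ x, x ≠ a → x ≠ b → x ∈ G) → a ∈ B → a ∉ G → b ∉ G := by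
      intro a b hsub ha haG hbG
      refine (hBmem a).1 ha ?_
      convert hG
      ext x
      simp only [Finset.mem_compl, Finset.mem_singleton]
      constructor
      · intro hx
        by_cases hxb : x = b
        · exact hxb ▸ hbG
        · exact hsub x hx hxb
      · rintro hx rfl
        exact haG hx
    have hnot : a ∉ G ∧ b ∉ G := by
      by_cases haG : a ∈ G
      · by_cases hbG : b ∈ G
        · refine absurd (Finset.eq_univ_iff_forall.2 fun x => ?_) hGu
          by_cases h1 : x = a
          · exact h1 ▸ haG
          by_cases h2 : x = b
          · exact h2 ▸ hbG
          exact hsub x h1 h2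
        · exact absurd haG (aux b a (fun x h1 h2 => hsub x h2 h1) hb hbG)
      · exact ⟨haG, aux a b hsub ha haG⟩
    convert hG
    ext x
    simp only [Finset.mem_compl, Finset.mem_insert, Finset.mem_singleton, not_or]
    exact ⟨fun h => hsub x h.1 h.2, fun hx => ⟨fun h => hnot.1 (h ▸ hx), fun h => hnot.2 (h ▸ hx)⟩⟩
  have hmem : ∀ S : Finset (Fin k), (B \ S).card ≠ 1 → S ∈ J := by
    intro S hS
    refine mem_of_forall_separated huniv hinter S fun r hr => ?_
    by_cases hrB : r ∈ B
    · have hr' : r ∈ B \ S := Finset.mem_sdiff.2 ⟨hrB, hr⟩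
      have : 1 < (B \ S).card := by
        have := Finset.card_pos.2 ⟨r, hr'⟩
        omega
      obtain ⟨r', hr'', hne⟩ := Finset.exists_mem_ne this r
      rw [Finset.mem_sdiff] at hr''
      refine ⟨_, hcompl r r' hne.symm hrB hr''.1, fun x hx => ?_, by simp⟩
      simp only [Finset.mem_compl, Finset.mem_insert, Finset.mem_singleton, not_or]
      exact ⟨fun h => hr (h ▸ hx), fun h => hr''.2 (h ▸ hx)⟩
    · refine ⟨{r}ᶜ, not_not.1 fun h => hrB ((hBmem r).2 h), fun x hx => ?_, by simp⟩
      simp only [Finset.mem_compl, Finset.mem_singleton]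
      exact fun h => hr (h ▸ hx)
  have hcardB : B.card ≤ k := by simpa using Finset.card_le_univ B
  have hsd : ∀ S : Finset (Fin k), (B \ S).card = B.card - (S ∩ B).card :=
    fun S => Finset.card_sdiff
  by_cases hB1 : B.card ≤ 1
  · left
    have : ∃ p, B ⊆ {p} := by
      rcases B.eq_empty_or_nonempty with h | ⟨p, hp⟩
      · exact ⟨⟨0, by omega⟩, by simp [h]⟩
      · exact ⟨p, fun x hx => Finset.mem_singleton.2 (Finset.card_le_one.1 hB1 x hx p hp)⟩
    obtain ⟨p, hp⟩ := this
    refine ⟨p, fun q _ => hmem _ ?_⟩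
    rw [Finset.card_eq_zero.2]
    · omega
    · rw [Finset.sdiff_eq_empty_iff_subset]
      exact hp.trans (by simp)
  · right
    -- a set of at least three positions that contains at most `|B| - 2` points of `B`
    have : ∃ P : Finset (Fin k), P.card = 3 ∧ ∀ S ⊆ P, S.card = 2 → (S ∩ B).card + 2 ≤ B.card := by
      by_cases h4 : 4 ≤ B.card
      · obtain ⟨P, -, hP⟩ := Finset.exists_subset_card_eq (s := (Finset.univ : Finset (Fin k)))
          (n := 3) (by simp; omega)
        refine ⟨P, hP, fun S _ hS2 => ?_⟩
        have := Finset.card_le_card (Finset.inter_subset_left : S ∩ B ⊆ S)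
        omega
      · have hBc : Bᶜ.card = k - B.card := by rw [Finset.card_compl, Fintype.card_fin]
        by_cases h3 : B.card = 2
        · obtain ⟨P, hP, hPc⟩ := Finset.exists_subset_card_eq (s := Bᶜ) (n := 3) (by omega)
          refine ⟨P, hPc, fun S hS _ => ?_⟩
          have : S ∩ B = ∅ := by
            rw [← Finset.disjoint_iff_inter_eq_empty]
            exact Finset.disjoint_of_subset_left (hS.trans hP) disjoint_compl_left
          rw [this]
          simp
          omega
        · obtain ⟨P, hP, hPc⟩ := Finset.exists_subset_card_eq (s := Bᶜ) (n := 2) (by omega)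
          obtain ⟨b, hb⟩ : B.Nonempty := Finset.card_pos.1 (by omega)
          have hbP : b ∉ P := fun h => by simpa [hb] using hP h
          refine ⟨insert b P, by rw [Finset.card_insert_of_notMem hbP, hPc], fun S hS _ => ?_⟩
          have : S ∩ B ⊆ {b} := fun x hx => by
            rw [Finset.mem_inter] at hx
            rcases Finset.mem_insert.1 (hS hx.1) with h | h
            · simp [h]
            · exact absurd hx.2 (by simpa using hP h)
          have := Finset.card_le_card this
          rw [Finset.card_singleton] at this
          omega
    obtain ⟨P, hP3, hP⟩ := this
    obtain ⟨p, q, r, hpq, hpr, hqr, rfl⟩ := Finset.card_eq_three.1 hP3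
    have key : ∀ a b, a ≠ b → ({a, b} : Finset (Fin k)) ⊆ {p, q, r} → {a, b} ∈ J := by
      intro a b hab hsub
      have := hP _ hsub (Finset.card_pair hab)
      refine hmem _ ?_
      rw [hsd]
      omega
    refine ⟨p, q, r, hpq, hpr, hqr, key _ _ hpq ?_, key _ _ hpr ?_, key _ _ hqr ?_⟩ <;>
      intro x <;> simp <;> tauto

/-- An intersection-closed pattern without singletons covering all sets of size `k - 3` contains
all sets through some pair. -/
theorem exists_pair_of_no_singleton (hk : 5 ≤ k) (huniv : Finset.univ ∈ J)
    (hinter : ∀ σ ∈ J, ∀ τ ∈ J, σ ∩ τ ∈ J) (hsing : ∀ w, {w} ∉ J)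
    (hcov : ∀ D : Finset (Fin k), D.card = k - 3 → ∃ σ ∈ J, D ⊆ σ ∧ σ ≠ Finset.univ) :
    ∃ Z : Finset (Fin k), Z.card = 2 ∧ ∀ S, Z ⊆ S → S ∈ J := by
  have hcov' : ∀ a b c : Fin k, a ≠ b → a ≠ c → b ≠ c → ∃ σ ∈ J, σ ≠ Finset.univ ∧
      ∀ x, x ≠ a → x ≠ b → x ≠ c → x ∈ σ := by
    intro a b c hab hac hbc
    obtain ⟨σ, h1, h2, h3⟩ := hcov ({a, b, c}ᶜ) (by
      rw [Finset.card_compl, Fintype.card_fin, Finset.card_eq_three.2 ⟨a, b, c, hab, hac, hbc, rfl⟩])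
    exact ⟨σ, h1, h3, fun x hxa hxb hxc => h2 (by simp [hxa, hxb, hxc])⟩
  have hcompl : ∀ (G : Finset (Fin k)) (r : Fin k), G ∈ J → G ≠ Finset.univ →
      (∀ x, x ≠ r → x ∈ G) → {r}ᶜ ∈ J := by
    intro G r hG hGu hr
    convert hG
    ext x
    simp only [Finset.mem_compl, Finset.mem_singleton]
    refine ⟨hr x, ?_⟩
    rintro hx rfl
    refine hGu (Finset.eq_univ_iff_forall.2 fun y => ?_)
    by_cases hy : y = x
    · exact hy ▸ hx
    · exact hr y hy
  -- a minimal nonempty member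
  have hne : (J.filter fun σ => σ.Nonempty).Nonempty :=
    ⟨Finset.univ, Finset.mem_filter.2 ⟨huniv, ⟨⟨0, by omega⟩, by simp⟩⟩⟩
  obtain ⟨Z, hZ, hZmin⟩ := Finset.exists_min_image _ Finset.card hne
  obtain ⟨hZJ, hZne⟩ := Finset.mem_filter.1 hZ
  have hmin : ∀ A ∈ J, ∀ x ∈ A, x ∈ Z → Z ⊆ A := by
    intro A hA x hxA hxZ
    have h1 := hZmin (A ∩ Z) (Finset.mem_filter.2 ⟨hinter _ hA _ hZJ, ⟨x, by simp [hxA, hxZ]⟩⟩)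
    exact Finset.inter_eq_right.1 (Finset.eq_of_subset_of_card_le Finset.inter_subset_right h1)
  have hZu : Z ≠ Finset.univ := by
    rintro rfl
    obtain ⟨σ, h1, h2, h3⟩ := hcov' ⟨0, by omega⟩ ⟨1, by omega⟩ ⟨2, by omega⟩ (by simp) (by simp)
      (by simp)
    have := hmin σ h1 ⟨3, by omega⟩ (h3 _ (by simp) (by simp) (by simp)) (by simp)
    exact h2 (Finset.univ_subset_iff.1 this)
  have hZ1 : Z.card ≠ 1 := fun h => by
    obtain ⟨w, rfl⟩ := Finset.card_eq_one.1 h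
    exact hsing w hZJ
  have hZpos := hZne.card_pos
  obtain ⟨z₁, hz₁, z₂, hz₂, hz₁₂⟩ := Finset.one_lt_card.1 (show 1 < Z.card by omega)
  by_cases hZ3 : 3 ≤ Z.card
  · exfalso
    obtain ⟨z₃, hz₃, hz₃'⟩ := Finset.exists_mem_notMem_of_card_lt_card
      (show ({z₁, z₂} : Finset (Fin k)).card < Z.card by rw [Finset.card_pair hz₁₂]; omega)
    simp only [Finset.mem_insert, Finset.mem_singleton, not_or] at hz₃'
    have hout : ∀ r ∉ Z, {r}ᶜ ∈ J := by
      intro r hr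
      have hrne : ∀ z ∈ Z, z ≠ r := fun z hz h => hr (h ▸ hz)
      obtain ⟨σ, h1, h2, h3⟩ := hcov' z₁ z₂ r hz₁₂ (hrne _ hz₁) (hrne _ hz₂)
      have hZσ := hmin σ h1 z₃ (h3 _ hz₃'.1 hz₃'.2 (hrne _ hz₃)) hz₃
      refine hcompl σ r h1 h2 fun x hx => ?_
      by_cases hxZ : x ∈ Z
      · exact hZσ hxZ
      · exact h3 x (fun h => hxZ (h ▸ hz₁)) (fun h => hxZ (h ▸ hz₂)) hx
    obtain ⟨σ, h1, h2, h3⟩ := hcov' z₁ z₂ z₃ hz₁₂ (Ne.symm hz₃'.1) (Ne.symm hz₃'.2)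
    have hnot : ∀ x ∈ Z, x ∉ σ := by
      intro x hx hxσ
      have hZσ := hmin σ h1 x hxσ hx
      refine h2 (Finset.eq_univ_iff_forall.2 fun y => ?_)
      by_cases hyZ : y ∈ Z
      · exact hZσ hyZ
      · exact h3 y (fun h => hyZ (h ▸ hz₁)) (fun h => hyZ (h ▸ hz₂)) (fun h => hyZ (h ▸ hz₃))
    obtain ⟨w, hw⟩ : ∃ w, w ∉ Z := by
      by_contra! h
      exact hZu (Finset.eq_univ_iff_forall.2 h)
    have hwσ : w ∈ σ :=
      h3 w (fun h => hw (h ▸ hz₁)) (fun h => hw (h ▸ hz₂)) (fun h => hw (h ▸ hz₃))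
    refine hsing w (mem_of_forall_separated huniv hinter _ fun r hr => ?_)
    rw [Finset.mem_singleton] at hr
    by_cases hrZ : r ∈ Z
    · exact ⟨σ, h1, by simpa using hwσ, hnot r hrZ⟩
    · exact ⟨{r}ᶜ, hout r hrZ, by simpa using hr, by simp⟩
  have hZ2 : Z.card = 2 := by omega
  have hZeq : Z = {z₁, z₂} := by
    symm
    refine Finset.eq_of_subset_of_card_le ?_ (by rw [Finset.card_pair hz₁₂, hZ2])
    intro x hx
    rcases Finset.mem_insert.1 hx with rfl | h
    · exact hz₁
    · exact Finset.mem_singleton.1 h ▸ hz₂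
  have hZmem : ∀ x, x ∈ Z ↔ x = z₁ ∨ x = z₂ := by simp [hZeq]
  set Q : Finset (Fin k) := Zᶜ.filter fun r => {r}ᶜ ∉ J with hQdef
  have hQ : ∀ r, r ∈ Q ↔ r ∉ Z ∧ {r}ᶜ ∉ J := by simp [hQdef]
  by_cases hQe : Q = ∅
  · refine ⟨Z, hZ2, fun S hZS => mem_of_forall_separated huniv hinter S fun r hr => ?_⟩
    refine ⟨{r}ᶜ, ?_, fun x hx => ?_, by simp⟩
    · by_contra h
      have : r ∈ Q := (hQ r).2 ⟨fun h => hr (hZS h), h⟩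
      simp [hQe] at this
    · simp only [Finset.mem_compl, Finset.mem_singleton]
      exact fun h => hr (h ▸ hx)
  exfalso
  have hZout : ∀ r ∉ Z, r ≠ z₁ ∧ r ≠ z₂ := fun r hr =>
    ⟨fun h => hr (h ▸ hz₁), fun h => hr (h ▸ hz₂)⟩
  have hI : ∀ r ∈ Q, ∀ r' ∈ Q, r ≠ r' → ∃ G ∈ J, r ∉ G ∧ ∀ x, x ≠ r → x ≠ r' → x ∈ G := by
    intro r hr r' hr' hrr'
    rw [hQ] at hr hr'
    obtain ⟨G, h1, h2, h3⟩ := hcov' z₁ r r' (hZout _ hr.1).1.symm (hZout _ hr'.1).1.symm hrr'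
    have hZG := hmin G h1 z₂ (h3 z₂ hz₁₂.symm (hZout _ hr.1).2.symm (hZout _ hr'.1).2.symm) hz₂
    have hG : ∀ x, x ≠ r → x ≠ r' → x ∈ G := by
      intro x hx hx'
      by_cases hxz : x = z₁
      · exact hxz ▸ hZG hz₁
      · exact h3 x hxz hx hx'
    refine ⟨G, h1, fun hrG => hr'.2 (hcompl G r' h1 h2 fun x hx => ?_), hG⟩
    by_cases hxr : x = r
    · exact hxr ▸ hrG
    · exact hG x hxr hx
  have hII : ∀ r ∈ Q, ∃ G ∈ J, (∀ x ∈ Z, x ∉ G) ∧ ∀ x ∉ Z, x ≠ r → x ∈ G := by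
    intro r hr
    rw [hQ] at hr
    obtain ⟨G, h1, h2, h3⟩ := hcov' z₁ z₂ r hz₁₂ (hZout _ hr.1).1.symm (hZout _ hr.1).2.symm
    refine ⟨G, h1, fun x hx hxG => hr.2 (hcompl G r h1 h2 fun y hy => ?_), fun x hx hxr =>
      h3 x (hZout x hx).1 (hZout x hx).2 hxr⟩
    by_cases hyZ : y ∈ Z
    · exact hmin G h1 x hxG hx hyZ
    · exact h3 y (hZout y hyZ).1 (hZout y hyZ).2 hy
  have hP : ∀ q, q ∉ Z → q ∉ Q → {q}ᶜ ∈ J := fun q h1 h2 => by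
    by_contra h
    exact h2 ((hQ q).2 ⟨h1, h⟩)
  have hZc : Zᶜ.card = k - 2 := by rw [Finset.card_compl, Fintype.card_fin, hZ2]
  have hQsub : Q ⊆ Zᶜ := Finset.filter_subset _ _
  have hQpos : 0 < Q.card := Finset.card_pos.2 (Finset.nonempty_iff_ne_empty.2 hQe)
  by_cases hQ1 : Q.card = 1
  · obtain ⟨r, hr⟩ := Finset.card_eq_one.1 hQ1
    have hrQ : r ∈ Q := by simp [hr]
    obtain ⟨G, h1, h2, h3⟩ := hII r hrQ
    have hq : ∀ q, q ∉ Z → q ≠ r → {q}ᶜ ∈ J := fun q h1 h2 => hP q h1 (by simpa [hr] using h2)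
    by_cases hrG : r ∈ G
    · refine hsing r (mem_of_forall_separated huniv hinter _ fun q hqr => ?_)
      rw [Finset.mem_singleton] at hqr
      by_cases hqZ : q ∈ Z
      · exact ⟨G, h1, by simpa using hrG, h2 q hqZ⟩
      · exact ⟨{q}ᶜ, hq q hqZ hqr, by simpa using hqr, by simp⟩
    · obtain ⟨w, hw, hwr⟩ := Finset.exists_mem_ne (show 1 < Zᶜ.card by omega) r
      rw [Finset.mem_compl] at hw
      refine hsing w (mem_of_forall_separated huniv hinter _ fun q hqw => ?_)
      rw [Finset.mem_singleton] at hqw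
      by_cases hqZ : q ∈ Z
      · exact ⟨G, h1, by simpa using h3 w hw hwr, h2 q hqZ⟩
      by_cases hqr : q = r
      · exact ⟨G, h1, by simpa using h3 w hw hwr, hqr ▸ hrG⟩
      · exact ⟨{q}ᶜ, hq q hqZ hqr, by simpa using hqw, by simp⟩
  · have : ∃ w ∉ Z, 2 ≤ (Q.erase w).card := by
      by_cases hQZ : Q = Zᶜ
      · obtain ⟨w, hw⟩ := Finset.card_pos.1 hQpos
        refine ⟨w, ((hQ w).1 hw).1, ?_⟩
        rw [Finset.card_erase_of_mem hw, hQZ]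
        omega
      · obtain ⟨w, hw, hwQ⟩ := Finset.exists_of_ssubset (hQsub.ssubset_of_ne hQZ)
        refine ⟨w, by simpa using hw, ?_⟩
        rw [Finset.erase_eq_of_notMem hwQ]
        omega
    obtain ⟨w, hw, hQw⟩ := this
    refine hsing w (mem_of_forall_separated huniv hinter _ fun q hqw => ?_)
    rw [Finset.mem_singleton] at hqw
    by_cases hqZ : q ∈ Z
    · obtain ⟨r, hr⟩ := Finset.card_pos.1 (show 0 < (Q.erase w).card by omega)
      rw [Finset.mem_erase] at hr
      obtain ⟨G, h1, h2, h3⟩ := hII r hr.2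
      exact ⟨G, h1, by simpa using h3 w hw (Ne.symm hr.1), h2 q hqZ⟩
    by_cases hqQ : q ∈ Q
    · obtain ⟨r, hr, hrq⟩ := Finset.exists_mem_ne (show 1 < (Q.erase w).card by omega) q
      rw [Finset.mem_erase] at hr
      obtain ⟨G, h1, h2, h3⟩ := hI q hqQ r hr.2 (Ne.symm hrq)
      exact ⟨G, h1, by simpa using h3 w (Ne.symm hqw) (Ne.symm hr.1), h2⟩
    · exact ⟨{q}ᶜ, hP q hqZ hqQ, by simpa using hqw, by simp⟩

end Patterns

section Wheel

variable {n k s ℓ : ℕ} {H : Finset (Finset (Fin n))}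

theorem exists_linearCycle_of_triangle (hk : ∀ e ∈ H, e.card = k) (hk2 : 2 ≤ k) (hℓ : 3 ≤ ℓ)
    (hs : 2 * k * ℓ ≤ s) {G : Finset (Fin k → Fin n)} {J : Finset (Finset (Fin k))}
    (hGne : G.Nonempty) (hG : ∀ f ∈ G, Function.Injective f ∧ Finset.univ.image f ∈ H)
    (hker : ∀ f ∈ G, ∀ σ ∈ J, IsMapKernel G s f σ) {p q r : Fin k} (hpq : p ≠ q) (hpr : p ≠ r)
    (hqr : q ≠ r) (h1 : {p, q} ∈ J) (h2 : {p, r} ∈ J) (h3 : {q, r} ∈ J) :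
    ∃ A : ZMod ℓ → Finset (Fin n), IsLinearCycle k ℓ A ∧ ∀ i, A i ∈ H := by
  obtain ⟨f₀, hf₀⟩ := hGne
  have hK : ∀ f ∈ G, ∀ a b, {a, b} ∈ J → IsKernel H s {f a, f b} := fun f hf a b hab => by
    have := (hker f hf _ hab).isKernel_image fun f hf => (hG f hf).2
    rwa [Finset.image_insert, Finset.image_singleton] at this
  set a := f₀ p with ha
  have key : ∀ m, m + 2 ≤ ℓ → ∃ f ∈ G, ∃ q' r', p ≠ q' ∧ p ≠ r' ∧ q' ≠ r' ∧ {p, q'} ∈ J ∧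
      {p, r'} ∈ J ∧ {q', r'} ∈ J ∧ f p = a ∧ ∃ b : ℕ → Fin n, b m = f q' ∧ b (m + 1) = f r' ∧
      (∀ i < m + 2, ∀ j < m + 2, b i = b j → i = j) ∧ (∀ i < m + 2, b i ≠ a) ∧
      (∀ i < m + 2, IsKernel H s {a, b i}) ∧ ∀ i < m + 1, IsKernel H s {b i, b (i + 1)} := by
    intro m
    induction m with
    | zero =>
      intro _
      have hinj := (hG f₀ hf₀).1
      refine ⟨f₀, hf₀, q, r, hpq, hpr, hqr, h1, h2, h3, rfl,
        fun i => if i = 0 then f₀ q else f₀ r, by simp, by simp, ?_, ?_, ?_, ?_⟩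
      · intro i hi j hj hij
        rcases (show i = 0 ∨ i = 1 by omega) with rfl | rfl <;>
          rcases (show j = 0 ∨ j = 1 by omega) with rfl | rfl <;> simp at hij ⊢
        · exact hqr (hinj hij)
        · exact hqr (hinj hij).symm
      · intro i hi
        rcases (show i = 0 ∨ i = 1 by omega) with rfl | rfl <;> simp
        · exact fun h => hpq (hinj h).symm
        · exact fun h => hpr (hinj h).symm
      · intro i hi
        rcases (show i = 0 ∨ i = 1 by omega) with rfl | rfl <;> simp
        · exact hK _ hf₀ _ _ h1
        · exact hK _ hf₀ _ _ h2
      · intro i hi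
        obtain rfl : i = 0 := by omega
        simpa using hK _ hf₀ _ _ h3
    | succ m ih =>
      intro hm
      obtain ⟨f, hf, q, r, hpq, hpr, hqr, h1, h2, h3, hfa, b, hb0, hb1, hinj, hba, hab, hbb⟩ :=
        ih (by omega)
      obtain ⟨g, hg, hgf, hgU⟩ := hker f hf _ h2 ((Finset.range (m + 2)).image b) (by
        refine Finset.card_image_le.trans ?_
        rw [Finset.card_range]
        nlinarith)
      have hgp : g p = a := (hgf p (by simp)).trans hfa
      have hgr : g r = b (m + 1) := (hgf r (by simp)).trans hb1.symm
      have hgq := hgU q (by simp [hpq.symm, hqr])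
      simp only [Finset.mem_image, Finset.mem_range, not_exists, not_and] at hgq
      have hu : ∀ i < m + 2, Function.update b (m + 2) (g q) i = b i := fun i hi =>
        Function.update_of_ne (by omega) _ _
      have hu' : Function.update b (m + 2) (g q) (m + 2) = g q := Function.update_self _ _ _
      refine ⟨g, hg, r, q, hpr, hpq, hqr.symm, h2, h1, by rwa [Finset.pair_comm], hgp,
        Function.update b (m + 2) (g q), ?_, hu', ?_, ?_, ?_, ?_⟩
      · rw [hu _ (by omega), hgr]
      · intro i hi j hj hij
        rcases (show i < m + 2 ∨ i = m + 2 by omega) with hi | rfl <;>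
          rcases (show j < m + 2 ∨ j = m + 2 by omega) with hj | rfl
        · rw [hu i hi, hu j hj] at hij
          exact hinj i hi j hj hij
        · rw [hu i hi, hu'] at hij
          exact absurd hij (hgq i hi)
        · rw [hu j hj, hu'] at hij
          exact absurd hij.symm (hgq j hj)
        · rfl
      · intro i hi
        rcases (show i < m + 2 ∨ i = m + 2 by omega) with hi | rfl
        · rw [hu i hi]; exact hba i hi
        · rw [hu', ← hgp]
          exact fun h => hpq ((hG g hg).1 h).symm
      · intro i hi
        rcases (show i < m + 2 ∨ i = m + 2 by omega) with hi | rfl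
        · rw [hu i hi]; exact hab i hi
        · rw [hu', ← hgp]
          exact hK _ hg _ _ h1
      · intro i hi
        rcases (show i < m + 1 ∨ i = m + 1 by omega) with hi | rfl
        · rw [hu i (by omega), hu (i + 1) (by omega)]; exact hbb i hi
        · rw [hu (m + 1) (by omega), hu', ← hgr, Finset.pair_comm]
          exact hK _ hg _ _ h3
  obtain ⟨m, rfl⟩ : ∃ m, ℓ = m + 3 := ⟨ℓ - 3, by omega⟩
  obtain ⟨-, -, -, -, -, -, -, -, -, -, -, b, -, -, hinj, hba, hab, hbb⟩ := key m (by omega)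
  have hs' : ∀ i, (fun i => if i = 0 then a else b (i - 1)) (i + 1) = b i := by simp
  refine exists_linearCycle_of_pairs hk hk2 hℓ hs (fun i => if i = 0 then a else b (i - 1))
    ?_ ?_ ?_
  · intro i hi j hj hij
    rcases i with - | i <;> rcases j with - | j <;> simp at hij
    · rfl
    · exact absurd hij.symm (hba j (by omega))
    · exact absurd hij (hba i (by omega))
    · rw [hinj i (by omega) j (by omega) hij]
  · intro i hi
    rcases i with - | i
    · simpa using hab 0 (by omega)
    · simpa using hbb i (by omega)
  · have := hab (m + 1) (by omega)
    rw [Finset.pair_comm]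
    simpa using this

/-- In a family without linear cycles, almost all edges have a point that forms kernels together
with all other points of the edge. -/
theorem card_filter_not_star_le (hk : ∀ e ∈ H, e.card = k) (hk5 : 5 ≤ k) (hℓ : 3 ≤ ℓ)
    (hs : 2 * k * ℓ ≤ s)
    (hfree : ¬ ∃ A : ZMod ℓ → Finset (Fin n), IsLinearCycle k ℓ A ∧ ∀ i, A i ∈ H) :
    (H.filter fun e => ¬ ∃ x ∈ e, ∀ b ∈ e, b ≠ x → IsKernel H s {x, b}).card ≤
      (2 ^ k + 1) ^ 2 ^ k * (k * s + 1) ^ k * n ^ (k - 2) := by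
  by_contra hlt
  rw [not_le] at hlt
  set N := H.filter fun e => ¬ ∃ x ∈ e, ∀ b ∈ e, b ≠ x → IsKernel H s {x, b} with hN
  have hNH : N ⊆ H := Finset.filter_subset _ _
  obtain ⟨G, J, hGne, hG, hker, huniv, hinter, hcov⟩ := exists_homogeneous s (k - 2) N
    (fun e he => hk e (hNH he)) (by rwa [Fintype.card_fin])
  rcases star_or_triangle hk5 huniv hinter hcov with ⟨p, hp⟩ | ⟨p, q, r, hpq, hpr, hqr, h1, h2, h3⟩
  · obtain ⟨f, hf⟩ := hGne
    refine (Finset.mem_filter.1 (hG f hf).2).2 ⟨f p, by simp, fun b hb hbp => ?_⟩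
    obtain ⟨q, -, rfl⟩ := Finset.mem_image.1 hb
    have := ((hker f hf _ (hp q fun h => hbp (h ▸ rfl))).isKernel_image
      fun f hf => (hG f hf).2).mono hNH
    rwa [Finset.image_insert, Finset.image_singleton] at this
  · exact hfree (exists_linearCycle_of_triangle hk (by omega) hℓ hs hGne
      (fun f hf => ⟨(hG f hf).1, hNH (hG f hf).2⟩) hker hpq hpr hqr h1 h2 h3)

end Wheel

section Asymptotics

theorem pow_le_mul_choose (c r : ℕ) {m : ℕ} (hm : 2 * (c + r) ≤ m) :
    m ^ r ≤ 2 ^ r * r.factorial * (m - c).choose r := by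
  have h1 := Nat.pow_sub_le_descFactorial (m - c) r
  rw [Nat.descFactorial_eq_factorial_mul_choose] at h1
  calc m ^ r ≤ (2 * (m - c + 1 - r)) ^ r := Nat.pow_le_pow_left (by omega) r
    _ = 2 ^ r * (m - c + 1 - r) ^ r := mul_pow _ _ _
    _ ≤ 2 ^ r * (r.factorial * (m - c).choose r) := Nat.mul_le_mul_left _ h1
    _ = _ := (mul_assoc _ _ _).symm

theorem choose_add_mul_choose_le (a q r : ℕ) :
    a.choose (r + 1) + q * a.choose r ≤ (a + q).choose (r + 1) := by
  induction q with
  | zero => simp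
  | succ q ih =>
    have h1 : a.choose r ≤ (a + q).choose r := Nat.choose_le_choose r (by omega)
    rw [← add_assoc, Nat.choose_succ_succ, Nat.succ_eq_add_one, add_mul]
    omega

/-- For every `c` and `d`, eventually `c * m ^ r < (m - d).choose (r + 1)`. -/
theorem exists_mul_pow_lt_choose (c d r : ℕ) :
    ∃ m₀ : ℕ, ∀ m ≥ m₀, c * m ^ r < (m - d).choose (r + 1) := by
  refine ⟨2 * (d + (r + 1)) + c * (2 ^ (r + 1) * (r + 1).factorial) + 1, fun m hm => ?_⟩
  have h1 := pow_le_mul_choose d (r + 1) (m := m) (by omega)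
  have hpos : 0 < 2 ^ (r + 1) * (r + 1).factorial := by positivity
  have hm0 : 0 < m ^ r := Nat.pow_pos (by omega)
  by_contra! h
  have h2 : m * m ^ r ≤ (c * (2 ^ (r + 1) * (r + 1).factorial)) * m ^ r := by
    calc m * m ^ r = m ^ (r + 1) := by ring
      _ ≤ _ := h1
      _ ≤ 2 ^ (r + 1) * (r + 1).factorial * (c * m ^ r) := Nat.mul_le_mul_left _ h
      _ = _ := by ring
  have := Nat.le_of_mul_le_mul_right h2 hm0
  omega

end Asymptotics

section NoSingleton

variable {α : Type*} [DecidableEq α] {F : Finset (Finset α)} {k s : ℕ}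

theorem card_inter_ne_one_of_isKernel (hk : ∀ e ∈ F, e.card = k) (hs : 4 * k ≤ s)
    (hF : ∀ e ∈ F, ∀ f ∈ F, (e ∩ f).card ≠ 1) {S T : Finset α} (hS : IsKernel F s S)
    (hT : IsKernel F s T) : (S ∩ T).card ≠ 1 := by
  obtain ⟨E, hE, -, hE'⟩ := exists_edges_of_isKernel (ι := Bool) (s := s) hk
    (by rw [Fintype.card_bool]; linarith) (fun b => if b then S else T)
    (fun b => by cases b <;> simpa)
  have := hE' true false (by simp)
  simp only [if_true, Bool.false_eq_true, if_false] at this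
  exact this ▸ hF _ (hE _) _ (hE _)

/-- `Z` is a pair such that all sets between `Z` and `e` are kernels. -/
def IsCore (F : Finset (Finset α)) (s : ℕ) (e Z : Finset α) : Prop :=
  Z ⊆ e ∧ Z.card = 2 ∧ ∀ S, Z ⊆ S → S ⊆ e → IsKernel F s S

theorem IsCore.disjoint_of_not_subset (hk : ∀ e ∈ F, e.card = k) (hs : 4 * k ≤ s)
    (hF : ∀ e ∈ F, ∀ f ∈ F, (e ∩ f).card ≠ 1) {e f Z : Finset α} (hZ : IsCore F s e Z)
    (hf : f ∈ F) (hZf : ¬ Z ⊆ f) : Disjoint e f := by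
  have hne : ∀ S, Z ⊆ S → S ⊆ e → (S ∩ f).card ≠ 1 := fun S h1 h2 =>
    card_inter_ne_one_of_isKernel hk hs hF (hZ.2.2 S h1 h2) (isKernel_of_mem hf)
  have h0 : Z ∩ f = ∅ := by
    have h1 := hne Z subset_rfl hZ.1
    have h2 : (Z ∩ f).card < Z.card := Finset.card_lt_card
      ⟨Finset.inter_subset_left, fun h => hZf (h.trans Finset.inter_subset_right)⟩
    rw [hZ.2.1] at h2
    rw [← Finset.card_eq_zero]
    omega
  rw [Finset.disjoint_left]
  intro y hye hyf
  apply hne (insert y Z) (Finset.subset_insert _ _) (Finset.insert_subset hye hZ.1)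
  rw [Finset.insert_inter_of_mem hyf, h0]
  simp

theorem IsCore.disjoint_of_ne (hk : ∀ e ∈ F, e.card = k) (hs : 4 * k ≤ s)
    (hF : ∀ e ∈ F, ∀ f ∈ F, (e ∩ f).card ≠ 1) {e f Z Z' : Finset α} (hZ : IsCore F s e Z)
    (hf : f ∈ F) (hZ' : IsCore F s f Z') (hne : Z ≠ Z') : Disjoint e f := by
  refine hZ.disjoint_of_not_subset hk hs hF hf fun hZf => ?_
  have h1 := card_inter_ne_one_of_isKernel hk hs hF (hZ.2.2 Z subset_rfl hZ.1)
    (hZ'.2.2 Z' subset_rfl hZ'.1)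
  have h2 : (Z ∩ Z').card < 2 := by
    rw [← hZ.2.1]
    refine Finset.card_lt_card ⟨Finset.inter_subset_left, fun h => hne ?_⟩
    exact Finset.eq_of_subset_of_card_le (h.trans Finset.inter_subset_right)
      (by rw [hZ.2.1, hZ'.2.1])
  have h0 : Z ∩ Z' = ∅ := by
    rw [← Finset.card_eq_zero]
    omega
  obtain ⟨z, hz⟩ : Z.Nonempty := Finset.card_pos.1 (by rw [hZ.2.1]; norm_num)
  refine card_inter_ne_one_of_isKernel hk hs hF (hZ.2.2 Z subset_rfl hZ.1)
    (hZ'.2.2 (insert z Z') (Finset.subset_insert _ _)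
      (Finset.insert_subset (hZf hz) hZ'.1)) ?_
  rw [Finset.inter_insert_of_mem hz, h0]
  simp

theorem card_filter_not_isCore_le [Fintype α] (hk : ∀ e ∈ F, e.card = k) (hk5 : 5 ≤ k)
    (hs : 4 * k ≤ s) (hF : ∀ e ∈ F, ∀ f ∈ F, (e ∩ f).card ≠ 1)
    [DecidablePred fun e => ∃ Z, IsCore F s e Z] :
    (F.filter fun e => ¬ ∃ Z, IsCore F s e Z).card ≤
      (2 ^ k + 1) ^ 2 ^ k * (k * s + 1) ^ k * Fintype.card α ^ (k - 3) := by
  by_contra hlt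
  rw [not_le] at hlt
  set N := F.filter fun e => ¬ ∃ Z, IsCore F s e Z with hN
  have hNF : N ⊆ F := Finset.filter_subset _ _
  obtain ⟨G, J, ⟨f, hf⟩, hG, hker, huniv, hinter, hcov⟩ := exists_homogeneous s (k - 3) N
    (fun e he => hk e (hNF he)) hlt
  have hker' : ∀ σ ∈ J, IsKernel F s (σ.image f) := fun σ hσ =>
    ((hker f hf σ hσ).isKernel_image fun f hf => (hG f hf).2).mono hNF
  obtain ⟨Z, hZ2, hZ⟩ := exists_pair_of_no_singleton hk5 huniv hinter (fun w hw => by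
    have := hker' _ hw
    exact card_inter_ne_one_of_isKernel hk hs hF this this (by simp)) hcov
  refine (Finset.mem_filter.1 (hG f hf).2).2 ⟨Z.image f, Finset.image_subset_image (by simp),
    by rw [Finset.card_image_of_injective _ (hG f hf).1, hZ2], fun S hZS hS => ?_⟩
  obtain ⟨σ, -, rfl⟩ := Finset.subset_image_iff.1 hS
  exact hker' _ (hZ _ ((Finset.image_subset_image_iff (hG f hf).1).1 hZS))

theorem card_le_choose_of_subset_of_subset {k : ℕ} {A : Finset (Finset α)} {Z V : Finset α}
    (hA : ∀ e ∈ A, Z ⊆ e ∧ e ⊆ V ∧ e.card = k) (hZV : Z ⊆ V) :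
    A.card ≤ (V.card - Z.card).choose (k - Z.card) := by
  rw [← Finset.card_sdiff_of_subset hZV, ← Finset.card_powersetCard]
  refine Finset.card_le_card_of_injOn (fun e => e \ Z) (fun e he => ?_) fun e he f hf hef => ?_
  · obtain ⟨h1, h2, h3⟩ := hA e he
    rw [Finset.mem_coe, Finset.mem_powersetCard, Finset.card_sdiff_of_subset h1, h3]
    exact ⟨Finset.sdiff_subset_sdiff h2 subset_rfl, rfl⟩
  · rw [← Finset.sdiff_union_of_subset (hA e he).1, ← Finset.sdiff_union_of_subset (hA f hf).1]
    simp only at hef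
    rw [hef]

/-- If some pair is contained in all but few members, then the family has at most the size of the
family of all sets containing the pair. -/
theorem card_le_choose_of_most_contain [Fintype α] (hk : ∀ e ∈ F, e.card = k) (hk5 : 5 ≤ k)
    (hF : ∀ e ∈ F, ∀ f ∈ F, (e ∩ f).card ≠ 1) {Z W : Finset α} (hZ : Z.card = 2)
    (hW : ∀ f ∈ F, ¬ Z ⊆ f → f ⊆ W ∧ Disjoint Z f)
    (hlarge : 2 ^ W.card ≤ (Fintype.card α - (k + 2)).choose (k - 3)) :
    F.card ≤ (Fintype.card α - 2).choose (k - 2) := by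
  by_cases hall : ∀ f ∈ F, Z ⊆ f
  · have := card_le_choose_of_subset_of_subset (V := Finset.univ)
      (fun e he => ⟨hall e he, Finset.subset_univ _, hk e he⟩) (Finset.subset_univ Z)
    rwa [hZ, Finset.card_univ] at this
  push Not at hall
  obtain ⟨f, hf, hZf⟩ := hall
  obtain ⟨-, hZf'⟩ := hW f hf hZf
  obtain ⟨y, hy⟩ : f.Nonempty := Finset.card_pos.1 (by rw [hk f hf]; omega)
  have h1 : (F.filter fun e => ¬ Z ⊆ e).card ≤ 2 ^ W.card := by
    rw [← Finset.card_powerset]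
    refine Finset.card_le_card fun e he => ?_
    rw [Finset.mem_filter] at he
    exact Finset.mem_powerset.2 (hW e he.1 he.2).1
  set M := (Finset.powersetCard (k - 3) (Z ∪ f)ᶜ).image (fun R => insert y R ∪ Z) with hM
  have hyZ : y ∉ Z := fun h => Finset.disjoint_left.1 hZf' h hy
  have hR : ∀ R ∈ Finset.powersetCard (k - 3) (Z ∪ f)ᶜ, Disjoint R Z ∧ Disjoint R f ∧
      R.card = k - 3 := by
    intro R hR
    rw [Finset.mem_powersetCard, Finset.subset_compl_iff_disjoint_right,
      Finset.disjoint_union_right] at hR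
    exact ⟨hR.1.1, hR.1.2, hR.2⟩
  have hMcard : M.card = (Fintype.card α - (k + 2)).choose (k - 3) := by
    rw [hM, Finset.card_image_of_injOn, Finset.card_powersetCard, Finset.card_compl,
      Finset.card_union_of_disjoint hZf', hZ, hk f hf, add_comm]
    intro R hR1 R' hR2 h
    obtain ⟨a1, a2, a3⟩ := hR R hR1
    obtain ⟨b1, b2, b3⟩ := hR R' hR2
    have key : ∀ R : Finset α, Disjoint R Z → Disjoint R f → (insert y R ∪ Z) \ insert y Z = R := by
      intro R h1 h2
      rw [Finset.disjoint_left] at h1 h2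
      ext x
      simp only [Finset.mem_sdiff, Finset.mem_union, Finset.mem_insert, not_or]
      constructor
      · tauto
      · intro hx
        exact ⟨Or.inl (Or.inr hx), fun h => h2 hx (h ▸ hy), h1 hx⟩
    rw [← key R a1 a2, ← key R' b1 b2]
    simp only at h
    rw [h]
  have hdisj : Disjoint (F.filter fun e => Z ⊆ e) M := by
    rw [Finset.disjoint_left]
    intro e he heM
    obtain ⟨R, hR1, rfl⟩ := Finset.mem_image.1 heM
    obtain ⟨a1, a2, a3⟩ := hR R hR1
    apply hF _ (Finset.mem_filter.1 he).1 f hf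
    rw [Finset.union_inter_distrib_right, Finset.disjoint_iff_inter_eq_empty.1 hZf',
      Finset.union_empty, Finset.insert_inter_of_mem hy, Finset.disjoint_iff_inter_eq_empty.1 a2]
    simp
  have h2 : ((F.filter fun e => Z ⊆ e) ∪ M).card ≤ (Fintype.card α - 2).choose (k - 2) := by
    rw [← hZ, ← Finset.card_univ]
    refine card_le_choose_of_subset_of_subset (fun e he => ?_) (Finset.subset_univ Z)
    rcases Finset.mem_union.1 he with he | he
    · rw [Finset.mem_filter] at he
      exact ⟨he.2, Finset.subset_univ _, hk e he.1⟩
    · obtain ⟨R, hR1, rfl⟩ := Finset.mem_image.1 he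
      obtain ⟨a1, a2, a3⟩ := hR R hR1
      refine ⟨Finset.subset_union_right, Finset.subset_univ _, ?_⟩
      have hyR : y ∉ R := fun h => Finset.disjoint_left.1 a2 h hy
      rw [Finset.card_union_of_disjoint (Finset.disjoint_insert_left.2 ⟨hyZ, a1⟩),
        Finset.card_insert_of_notMem hyR, a3, hZ]
      omega
  rw [Finset.card_union_of_disjoint hdisj, hMcard] at h2
  have h3 := Finset.card_filter_add_card_filter_not (s := F) (fun e => Z ⊆ e)
  omega

/-- The vertex set of the edges with a fixed core is almost everything, if the family is large. -/
theorem exists_isCore_of_choose_lt_card [Fintype α] {q : ℕ} (hk : ∀ e ∈ F, e.card = k)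
    (hk5 : 5 ≤ k) (hs : 4 * k ≤ s) (hF : ∀ e ∈ F, ∀ f ∈ F, (e ∩ f).card ≠ 1)
    (hcard : (Fintype.card α - 2).choose (k - 2) < F.card)
    (hq : (2 + (k - 2) * ((2 ^ k + 1) ^ 2 ^ k * (k * s + 1) ^ k)) * Fintype.card α ^ (k - 3) ≤
      (Fintype.card α - 2) * (q * (Fintype.card α - (3 + q)).choose (k - 4)))
    (hm : q + 3 + k ≤ Fintype.card α) :
    ∃ (Z : Finset α) (A : Finset (Finset α)), (∀ e ∈ A, IsCore F s e Z) ∧ Z.card = 2 ∧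
      Z ⊆ A.biUnion id ∧ Fintype.card α < (A.biUnion id).card + q := by
  classical
  set m := Fintype.card α with hm_def
  set C := (2 ^ k + 1) ^ 2 ^ k * (k * s + 1) ^ k with hC
  obtain ⟨c, rfl⟩ : ∃ c, k = c + 4 := ⟨k - 4, by omega⟩
  simp only [show c + 4 - 3 = c + 1 by omega, show c + 4 - 4 = c by omega,
    show c + 4 - 2 = c + 2 by omega] at *
  have hφ : ∀ e : Finset α, ∃ Z : Finset α, (∃ Z, IsCore F s e Z) → IsCore F s e Z := by
    intro e
    by_cases h : ∃ Z, IsCore F s e Z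
    · exact ⟨h.choose, fun _ => h.choose_spec⟩
    · exact ⟨∅, fun h' => absurd h' h⟩
  choose φ hφ using hφ
  set T := F.filter fun e => ∃ Z, IsCore F s e Z with hT
  have hTφ : ∀ e ∈ T, IsCore F s e (φ e) := fun e he => hφ e (Finset.mem_filter.1 he).2
  set A : Finset α → Finset (Finset α) := fun Z => T.filter fun e => φ e = Z with hA
  set V : Finset α → Finset α := fun Z => (A Z).biUnion id with hV
  have hAcore : ∀ Z, ∀ e ∈ A Z, IsCore F s e Z := by
    intro Z e he
    rw [hA, Finset.mem_filter] at he
    exact he.2 ▸ hTφ e he.1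
  have hAF : ∀ Z, ∀ e ∈ A Z, e ∈ F := fun Z e he =>
    (Finset.mem_filter.1 (Finset.mem_filter.1 he).1).1
  have hZprop : ∀ Z ∈ T.image φ, Z.card = 2 ∧ Z ⊆ V Z := by
    intro Z hZ
    obtain ⟨e, he, rfl⟩ := Finset.mem_image.1 hZ
    have : e ∈ A (φ e) := Finset.mem_filter.2 ⟨he, rfl⟩
    exact ⟨(hTφ e he).2.1, (hTφ e he).1.trans (Finset.subset_biUnion_of_mem id this)⟩
  by_contra! hcon
  have hVq : ∀ Z ∈ T.image φ, (V Z).card + q ≤ m := fun Z hZ =>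
    hcon Z (A Z) (hAcore Z) (hZprop Z hZ).1 (hZprop Z hZ).2
  have hsumV : ∑ Z ∈ T.image φ, (V Z).card ≤ m := by
    rw [← Finset.card_biUnion]
    · exact Finset.card_le_univ _
    · intro Z _ Z' _ hne
      rw [Function.onFun, hV, Finset.disjoint_biUnion_left]
      intro e he
      rw [Finset.disjoint_biUnion_right]
      intro f hf
      exact (hAcore Z e he).disjoint_of_ne hk hs hF (hAF _ _ hf) (hAcore Z' f hf) hne
  have hAcard : ∀ Z ∈ T.image φ, (c + 2) * (A Z).card ≤
      (V Z).card * (m - (3 + q)).choose (c + 1) := by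
    intro Z hZ
    have h1 : (A Z).card ≤ ((V Z).card - 2).choose (c + 2) := by
      have := card_le_choose_of_subset_of_subset (fun e he => ⟨(hAcore Z e he).1,
        Finset.subset_biUnion_of_mem id he, hk e (hAF Z e he)⟩) (hZprop Z hZ).2
      rwa [(hZprop Z hZ).1] at this
    have h2 := hVq Z hZ
    rcases Nat.lt_or_ge (V Z).card 3 with h3 | h3
    · rw [Nat.choose_eq_zero_of_lt (by omega)] at h1
      rw [Nat.le_zero.1 h1]
      simp
    obtain ⟨a, ha⟩ : ∃ a, (V Z).card = a + 3 := ⟨(V Z).card - 3, by omega⟩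
    rw [ha, show a + 3 - 2 = a + 1 by omega] at h1
    have h4 := Nat.add_one_mul_choose_eq a (c + 1)
    have h5 : a.choose (c + 1) ≤ (m - (3 + q)).choose (c + 1) :=
      Nat.choose_le_choose _ (by omega)
    calc (c + 2) * (A Z).card ≤ (c + 2) * (a + 1).choose (c + 2) := Nat.mul_le_mul_left _ h1
      _ = (a + 1) * a.choose (c + 1) := by rw [h4]; ring
      _ ≤ (V Z).card * (m - (3 + q)).choose (c + 1) := Nat.mul_le_mul (by omega) h5
  have hTcard : (c + 2) * T.card ≤ m * (m - (3 + q)).choose (c + 1) := by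
    rw [Finset.card_eq_sum_card_image φ T, Finset.mul_sum]
    calc _ ≤ ∑ Z ∈ T.image φ, (V Z).card * (m - (3 + q)).choose (c + 1) :=
          Finset.sum_le_sum hAcard
      _ ≤ _ := by rw [← Finset.sum_mul]; exact Nat.mul_le_mul_right _ hsumV
  have hU : (F.filter fun e => ¬ ∃ Z, IsCore F s e Z).card ≤ C * m ^ (c + 1) :=
    card_filter_not_isCore_le hk hk5 hs hF
  have hsplit := Finset.card_filter_add_card_filter_not (s := F) (fun e => ∃ Z, IsCore F s e Z)
  obtain ⟨a, ha⟩ : ∃ a, m = a + q + 3 := ⟨m - (q + 3), by omega⟩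
  have h1 : (c + 2) * (m - 2).choose (c + 2) = (m - 2) * (m - 3).choose (c + 1) := by
    have := Nat.add_one_mul_choose_eq (m - 3) (c + 1)
    rw [show m - 2 = m - 3 + 1 by omega, this]; ring
  have h2 := choose_add_mul_choose_le (m - (3 + q)) q c
  rw [show m - (3 + q) + q = m - 3 by omega] at h2
  have h3 : (m - (3 + q)).choose (c + 1) ≤ m ^ (c + 1) :=
    (Nat.choose_le_pow _ _).trans (Nat.pow_le_pow_left (by omega) _)
  have h4 : (c + 2) * ((m - 2).choose (c + 2) + 1) ≤ (c + 2) * F.card :=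
    Nat.mul_le_mul_left _ hcard
  have h5 : (m - 2) * ((m - (3 + q)).choose (c + 1) + q * (m - (3 + q)).choose c) ≤
      (m - 2) * (m - 3).choose (c + 1) := Nat.mul_le_mul_left _ h2
  obtain ⟨b, hb⟩ : ∃ b, m = b + 2 := ⟨m - 2, by omega⟩
  have h6 : m * (m - (3 + q)).choose (c + 1) =
      (m - 2) * (m - (3 + q)).choose (c + 1) + 2 * (m - (3 + q)).choose (c + 1) := by
    rw [← add_mul, show m - 2 + 2 = m by omega]
  have h7 : (c + 2) * F.card = (c + 2) * T.card +
      (c + 2) * (F.filter fun e => ¬ ∃ Z, IsCore F s e Z).card := by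
    rw [← mul_add, hsplit]
  have h8 := Nat.mul_le_mul_left (c + 2) hU
  have h9 : (2 + (c + 2) * C) * m ^ (c + 1) = 2 * m ^ (c + 1) + (c + 2) * (C * m ^ (c + 1)) := by
    ring
  rw [h9] at hq
  rw [mul_add] at h4 h5
  omega

end NoSingleton

/-- **Frankl's theorem**: a large family of `k`-sets without singleton intersections has at most as
many members as the family of all `k`-sets containing a fixed pair. -/
theorem exists_forall_card_le_choose_of_card_inter_ne_one {k : ℕ} (hk5 : 5 ≤ k) :
    ∃ m₀ : ℕ, ∀ (α : Type) [Fintype α] [DecidableEq α] (F : Finset (Finset α)),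
      m₀ ≤ Fintype.card α → (∀ e ∈ F, e.card = k) →
      (∀ e ∈ F, ∀ f ∈ F, (e ∩ f).card ≠ 1) →
      F.card ≤ (Fintype.card α - 2).choose (k - 2) := by
  set D := 2 + (k - 2) * ((2 ^ k + 1) ^ 2 ^ k * (k * (4 * k) + 1) ^ k) with hD
  set q := 2 * D * (2 ^ (k - 4) * (k - 4).factorial) with hq
  obtain ⟨m₁, hm₁⟩ := exists_mul_pow_lt_choose (2 ^ q) (k + 2) (k - 4)
  refine ⟨m₁ + 2 * (3 + q + k), fun α _ _ F hm hk hF => ?_⟩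
  by_contra hcard
  rw [not_le] at hcard
  set m := Fintype.card α with hmd
  have hm0 : 0 < m := by omega
  obtain ⟨Z, A, hA, hZ, hZV, hV⟩ := exists_isCore_of_choose_lt_card (s := 4 * k) (q := q) hk hk5
    le_rfl hF hcard (by
      rw [← hmd, ← hD]
      have h1 := pow_le_mul_choose (3 + q) (k - 4) (m := m) (by omega)
      calc D * m ^ (k - 3) = D * (m * m ^ (k - 4)) := by
            rw [show k - 3 = k - 4 + 1 by omega, pow_succ']
        _ ≤ D * ((2 * (m - 2)) * (2 ^ (k - 4) * (k - 4).factorial *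
              (m - (3 + q)).choose (k - 4))) :=
            Nat.mul_le_mul_left _ (Nat.mul_le_mul (by omega) h1)
        _ = _ := by rw [hq]; ring) (by omega)
  refine absurd hcard (not_lt.2 (card_le_choose_of_most_contain hk hk5 hF hZ
    (W := (A.biUnion id)ᶜ) (fun f hf hZf => ?_) ?_))
  · have h1 : Disjoint (A.biUnion id) f := by
      rw [Finset.disjoint_biUnion_left]
      exact fun e he => (hA e he).disjoint_of_not_subset hk le_rfl hF hf hZf
    exact ⟨Finset.subset_compl_iff_disjoint_left.2 h1, h1.mono_left hZV⟩
  · have h1 : 2 ^ (A.biUnion id)ᶜ.card ≤ 2 ^ q := by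
      refine Nat.pow_le_pow_right (by norm_num) ?_
      rw [Finset.card_compl]
      omega
    have h2 := hm₁ m (by omega)
    rw [show k - 4 + 1 = k - 3 by omega] at h2
    have h3 : 2 ^ q * 1 ≤ 2 ^ q * m ^ (k - 4) := Nat.mul_le_mul_left _ (Nat.pow_pos hm0)
    rw [mul_one] at h3
    exact h1.trans (h3.trans h2.le)

section DoubleCounting

variable {α : Type*} [DecidableEq α]

theorem card_mul_le_card_mul_choose {a b m : ℕ} (A B : Finset (Finset α))
    (hA : ∀ P ∈ A, P.card = a) (hB : ∀ D ∈ B, D.card = b)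
    (h : ∀ P ∈ A, m ≤ (B.filter fun D => P ⊆ D).card) :
    A.card * m ≤ B.card * b.choose a := by
  refine Finset.card_mul_le_card_mul (fun P D : Finset α => P ⊆ D)
    (fun P hP => by simpa only [Finset.bipartiteAbove] using h P hP) fun D hD => ?_
  rw [← hB D hD, ← Finset.card_powersetCard]
  refine Finset.card_le_card fun P hP => ?_
  rw [Finset.mem_bipartiteBelow] at hP
  exact Finset.mem_powersetCard.2 ⟨hP.2, hA P hP.1⟩

variable [Fintype α]

theorem choose_le_card_filter_superset (Q : Finset α) {r : ℕ} (hQ : Q.card ≤ r) :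
    (Fintype.card α - Q.card).choose (r - Q.card) ≤
      ((Finset.powersetCard r Finset.univ).filter fun D => Q ⊆ D).card := by
  rw [← Finset.card_compl, ← Finset.card_powersetCard]
  have hR : ∀ R ∈ Finset.powersetCard (r - Q.card) Qᶜ, Disjoint R Q ∧ R.card = r - Q.card := by
    intro R hR
    rwa [Finset.mem_powersetCard, Finset.subset_compl_iff_disjoint_right] at hR
  refine Finset.card_le_card_of_injOn (fun R => R ∪ Q) (fun R h => ?_) fun R h R' h' heq => ?_
  · obtain ⟨h1, h2⟩ := hR R h
    simp only [Finset.mem_coe, Finset.mem_filter, Finset.mem_powersetCard_univ]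
    rw [Finset.card_union_of_disjoint h1]
    exact ⟨by omega, Finset.subset_union_right⟩
  · rw [← Finset.union_sdiff_cancel_right (hR R h).1,
      ← Finset.union_sdiff_cancel_right (hR R' h').1]
    simp only at heq
    rw [heq]

theorem card_filter_superset_le (Q : Finset α) (r : ℕ) :
    ((Finset.powersetCard r Finset.univ).filter fun D => Q ⊆ D).card ≤
      Fintype.card α ^ (r - Q.card) := by
  have h1 : ((Finset.powersetCard r Finset.univ).filter fun D => Q ⊆ D).card ≤
      (Fintype.card α - Q.card).choose (r - Q.card) :=
    card_le_choose_of_subset_of_subset (V := Finset.univ) (fun e he => by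
      rw [Finset.mem_filter, Finset.mem_powersetCard_univ] at he
      exact ⟨he.2, Finset.subset_univ _, he.1⟩) (Finset.subset_univ Q)
  exact h1.trans ((Nat.choose_le_pow _ _).trans (Nat.pow_le_pow_left (by omega) _))

/-- If all `r`-sets containing a member of `A` belong to a small family, then `A` is small. -/
theorem card_le_of_supersets_subset {a r C : ℕ} (har : a ≤ r) (hn : 2 * r ≤ Fintype.card α)
    (hn0 : 0 < Fintype.card α) (A B : Finset (Finset α))
    (hA : ∀ P ∈ A, P.card = a) (hB : ∀ D ∈ B, D.card = r) {j : ℕ}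
    (hBcard : B.card ≤ C * Fintype.card α ^ (j + (r - a)))
    (h : ∀ P ∈ A, ∀ D : Finset α, D.card = r → P ⊆ D → D ∈ B) :
    A.card ≤ 2 ^ (r - a) * (r - a).factorial * C * r.choose a * Fintype.card α ^ j := by
  have h1 := card_mul_le_card_mul_choose (m := (Fintype.card α - a).choose (r - a)) A B hA hB
    fun P hP => by
      rw [← hA P hP]
      refine (choose_le_card_filter_superset P (by rw [hA P hP]; exact har)).trans
        (Finset.card_le_card fun D hD => ?_)
      rw [Finset.mem_filter, Finset.mem_powersetCard_univ] at hD
      exact Finset.mem_filter.2 ⟨h P hP D hD.1 hD.2, hD.2⟩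
  have h2 := pow_le_mul_choose a (r - a) (m := Fintype.card α) (by omega)
  set n := Fintype.card α
  have h3 : 0 < n ^ (r - a) := Nat.pow_pos hn0
  refine Nat.le_of_mul_le_mul_right ?_ h3
  calc A.card * n ^ (r - a)
      ≤ A.card * (2 ^ (r - a) * (r - a).factorial * (n - a).choose (r - a)) :=
        Nat.mul_le_mul_left _ h2
    _ = 2 ^ (r - a) * (r - a).factorial * (A.card * (n - a).choose (r - a)) := by ring
    _ ≤ 2 ^ (r - a) * (r - a).factorial * (B.card * r.choose a) := Nat.mul_le_mul_left _ h1
    _ ≤ 2 ^ (r - a) * (r - a).factorial * (C * n ^ (j + (r - a)) * r.choose a) :=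
        Nat.mul_le_mul_left _ (Nat.mul_le_mul_right _ hBcard)
    _ = _ := by rw [pow_add]; ring

/-- A colouring of almost all `r`-sets in which sets sharing two points have the same colour is
almost constant. -/
theorem exists_color_of_almost_all {β : Type*} [Nonempty β] [DecidableEq β] {r C : ℕ} (hr : 4 ≤ r)
    (hn : 2 * r + 1 ≤ Fintype.card α) (G : Finset (Finset α)) (c : Finset α → β)
    (hG : ((Finset.powersetCard r Finset.univ).filter fun D => D ∉ G).card ≤
      C * Fintype.card α ^ (r - 1))
    (hc : ∀ D ∈ G, ∀ D' ∈ G, 2 ≤ (D ∩ D').card → c D = c D') :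
    ∃ T : β, ((Finset.powersetCard r Finset.univ).filter fun D => ¬ (D ∈ G ∧ c D = T)).card ≤
      (C + 48 * (2 ^ (r - 4) * (r - 4).factorial * C * r.choose 4)) *
        Fintype.card α ^ (r - 1) := by
  set n := Fintype.card α with hn_def
  set B := (Finset.powersetCard r Finset.univ).filter fun D => D ∉ G with hB
  set Q4 := (Finset.powersetCard 4 (Finset.univ : Finset α)).filter
    fun Q => ∀ D ∈ G, D.card = r → ¬ Q ⊆ D with hQ4
  set K := 2 ^ (r - 4) * (r - 4).factorial * C * r.choose 4 with hK
  have hQ4c : ∀ Q ∈ Q4, Q.card = 4 := fun Q hQ =>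
    Finset.mem_powersetCard_univ.1 (Finset.mem_filter.1 hQ).1
  have hQ4card : Q4.card ≤ K * n ^ 3 := by
    refine card_le_of_supersets_subset hr (by omega) (by omega) Q4 B hQ4c (fun D hD =>
      Finset.mem_powersetCard_univ.1 (Finset.mem_filter.1 hD).1)
      (by rwa [show 3 + (r - 4) = r - 1 by omega]) fun Q hQ D hD hQD => ?_
    exact Finset.mem_filter.2 ⟨Finset.mem_powersetCard_univ.2 hD, fun hDG =>
      (Finset.mem_filter.1 hQ).2 D hDG hD hQD⟩
  obtain ⟨P, hP, hPcard⟩ : ∃ P : Finset α, P.card = 2 ∧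
      (Q4.filter fun Q => P ⊆ Q).card ≤ 48 * K * n := by
    by_contra! hcon
    have h1 := card_mul_le_card_mul_choose (m := 48 * K * n + 1)
      (Finset.powersetCard 2 (Finset.univ : Finset α)) Q4
      (fun P hP => Finset.mem_powersetCard_univ.1 hP) hQ4c
      fun P hP => hcon P (Finset.mem_powersetCard_univ.1 hP)
    rw [Finset.card_powersetCard, Finset.card_univ, ← hn_def,
      show Nat.choose 4 2 = 6 from rfl] at h1
    have h2 := pow_le_mul_choose 0 2 (m := n) (by omega)
    simp only [Nat.sub_zero, Nat.factorial] at h2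
    have h3 : n ^ 2 * (48 * K * n + 1) ≤ 48 * (K * n ^ 3) := by
      calc n ^ 2 * (48 * K * n + 1) ≤ (8 * n.choose 2) * (48 * K * n + 1) :=
            Nat.mul_le_mul_right _ h2
        _ = 8 * (n.choose 2 * (48 * K * n + 1)) := by ring
        _ ≤ 8 * (Q4.card * 6) := Nat.mul_le_mul_left _ h1
        _ ≤ 48 * (K * n ^ 3) := by omega
    have h4 : 0 < n ^ 2 := Nat.pow_pos (by omega)
    nlinarith
  obtain ⟨T, hT⟩ : ∃ T : β, ∀ D ∈ G, P ⊆ D → c D = T := by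
    by_cases h : ∃ D ∈ G, P ⊆ D
    · obtain ⟨D, hD, hPD⟩ := h
      exact ⟨c D, fun D' hD' hPD' => hc D' hD' D hD
        (hP ▸ Finset.card_le_card (Finset.subset_inter hPD' hPD))⟩
    · exact ⟨Classical.arbitrary β, fun D hD hPD => absurd ⟨D, hD, hPD⟩ h⟩
  refine ⟨T, ?_⟩
  have hsub : ((Finset.powersetCard r Finset.univ).filter fun D => ¬ (D ∈ G ∧ c D = T)) ⊆
      B ∪ (Q4.filter fun Q => P ⊆ Q).biUnion fun Q =>
        (Finset.powersetCard r Finset.univ).filter fun D => Q \ P ⊆ D := by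
    intro D hD
    rw [Finset.mem_filter] at hD
    obtain ⟨hDr, hD⟩ := hD
    by_cases hDG : D ∈ G
    · have hcD : c D ≠ T := fun h => hD ⟨hDG, h⟩
      have hDr' := Finset.mem_powersetCard_univ.1 hDr
      have h2 : 2 ≤ (D \ P).card := by
        have := Finset.le_card_sdiff P D
        omega
      obtain ⟨Q, hQ, hQ2⟩ := Finset.exists_subset_card_eq h2
      have hQP : Disjoint Q P := Finset.disjoint_of_subset_left hQ Finset.sdiff_disjoint
      refine Finset.mem_union_right _ (Finset.mem_biUnion.2 ⟨Q ∪ P, ?_, ?_⟩)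
      · rw [Finset.mem_filter, hQ4, Finset.mem_filter, Finset.mem_powersetCard_univ,
          Finset.card_union_of_disjoint hQP, hQ2, hP]
        refine ⟨⟨rfl, fun D' hD' _ hsub => hcD ?_⟩, Finset.subset_union_right⟩
        rw [← hT D' hD' (Finset.subset_union_right.trans hsub)]
        exact hc D hDG D' hD' (hQ2 ▸ Finset.card_le_card (Finset.subset_inter
          (hQ.trans Finset.sdiff_subset) (Finset.subset_union_left.trans hsub)))
      · rw [Finset.mem_filter, Finset.union_sdiff_cancel_right hQP]
        exact ⟨hDr, hQ.trans Finset.sdiff_subset⟩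
    · exact Finset.mem_union_left _ (Finset.mem_filter.2 ⟨hDr, hDG⟩)
  have hbi := Finset.card_biUnion_le_card_mul (Q4.filter fun Q => P ⊆ Q)
    (fun Q => (Finset.powersetCard r Finset.univ).filter fun D => Q \ P ⊆ D) (n ^ (r - 2))
    fun Q hQ => by
      rw [Finset.mem_filter] at hQ
      have := card_filter_superset_le (Q \ P) r
      rwa [Finset.card_sdiff_of_subset hQ.2, hQ4c Q hQ.1, hP] at this
  calc _ ≤ _ := Finset.card_le_card hsub
    _ ≤ _ := Finset.card_union_le _ _
    _ ≤ C * n ^ (r - 1) + 48 * K * n * n ^ (r - 2) :=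
        Nat.add_le_add hG (hbi.trans (Nat.mul_le_mul_right _ hPcard))
    _ = _ := by
        rw [show r - 1 = r - 2 + 1 by omega, pow_succ]
        ring

end DoubleCounting

section Tops

variable {n k s t : ℕ} {H : Finset (Finset (Fin n))}

/-- The points `x` outside `D` for which `insert x D` is an edge and all pairs `{x, b}` with
`b ∈ D` are kernels. -/
noncomputable def tops (H : Finset (Finset (Fin n))) (s : ℕ) (D : Finset (Fin n)) :
    Finset (Fin n) :=
  Finset.univ.filter fun x => x ∉ D ∧ insert x D ∈ H ∧ ∀ b ∈ D, IsKernel H s {x, b}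

/-- The points that form kernels with both `x` and `y`. -/
noncomputable def commonLinks (H : Finset (Finset (Fin n))) (s : ℕ) (x y : Fin n) :
    Finset (Fin n) :=
  Finset.univ.filter fun b => IsKernel H s {x, b} ∧ IsKernel H s {y, b}

/-- Any two different members of `tops H s D` have at least `M` common links. -/
def IsRich (H : Finset (Finset (Fin n))) (s M : ℕ) (D : Finset (Fin n)) : Prop :=
  ∀ x ∈ tops H s D, ∀ y ∈ tops H s D, x ≠ y → M ≤ (commonLinks H s x y).card

noncomputable instance (H : Finset (Finset (Fin n))) (s M : ℕ) (D : Finset (Fin n)) :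
    Decidable (IsRich H s M D) := Classical.propDecidable _

theorem mem_tops {D : Finset (Fin n)} {x : Fin n} :
    x ∈ tops H s D ↔ x ∉ D ∧ insert x D ∈ H ∧ ∀ b ∈ D, IsKernel H s {x, b} := by
  simp [tops]

theorem card_le_sum_card_tops (hk : ∀ e ∈ H, e.card = k) :
    H.card ≤ (H.filter fun e => ¬ ∃ x ∈ e, ∀ b ∈ e, b ≠ x → IsKernel H s {x, b}).card +
      ∑ D ∈ Finset.powersetCard (k - 1) Finset.univ, (tops H s D).card := by
  rw [← Finset.card_filter_add_card_filter_not (s := H)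
    (fun e => ∃ x ∈ e, ∀ b ∈ e, b ≠ x → IsKernel H s {x, b}), add_comm]
  refine Nat.add_le_add_left ?_ _
  rw [← Finset.card_sigma]
  refine (Finset.card_le_card fun e he => ?_).trans (Finset.card_image_le
    (f := fun p : (_ : Finset (Fin n)) × Fin n => insert p.2 p.1))
  rw [Finset.mem_filter] at he
  obtain ⟨heH, x, hx, hxb⟩ := he
  refine Finset.mem_image.2 ⟨⟨e.erase x, x⟩, Finset.mem_sigma.2 ⟨?_, mem_tops.2 ⟨?_, ?_, ?_⟩⟩, ?_⟩
  · rw [Finset.mem_powersetCard_univ, Finset.card_erase_of_mem hx, hk e heH]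
  · simp
  · rwa [Finset.insert_erase hx]
  · intro b hb
    exact hxb b (Finset.mem_of_mem_erase hb) (Finset.ne_of_mem_erase hb)
  · exact Finset.insert_erase hx

theorem card_filter_not_isRich_le (𝒟 : Finset (Finset (Fin n))) (M : ℕ) :
    (𝒟.filter fun D => ¬ IsRich H s (M + 1) D).card ≤ n ^ 2 * 2 ^ M := by
  set P := (Finset.univ : Finset (Fin n × Fin n)).filter
    fun p => (commonLinks H s p.1 p.2).card ≤ M with hP
  have hPn : P.card ≤ n ^ 2 := by
    refine (Finset.card_le_univ _).trans ?_
    simp [sq]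
  refine (Finset.card_le_card (t := P.biUnion fun p => (commonLinks H s p.1 p.2).powerset)
    fun D hD => ?_).trans ((Finset.card_biUnion_le_card_mul _ _ (2 ^ M) fun p hp => ?_).trans
      (Nat.mul_le_mul_right _ hPn))
  · have h := (Finset.mem_filter.1 hD).2
    rw [IsRich] at h
    push Not at h
    obtain ⟨x, hx, y, hy, -, hxy⟩ := h
    rw [Finset.mem_biUnion]
    refine ⟨(x, y), Finset.mem_filter.2 ⟨Finset.mem_univ _, Nat.lt_succ_iff.1 hxy⟩, ?_⟩
    rw [Finset.mem_powerset]
    intro b hb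
    simp only [commonLinks, Finset.mem_filter, Finset.mem_univ, true_and]
    exact ⟨(mem_tops.1 hx).2.2 b hb, (mem_tops.1 hy).2.2 b hb⟩
  · rw [Finset.card_powerset]
    exact Nat.pow_le_pow_right (by norm_num) (Finset.mem_filter.1 hp).2

theorem mem_of_isRich (hk : ∀ e ∈ H, e.card = k) (hk2 : 2 ≤ k) (ht : 1 ≤ t)
    (hs : 2 * k * (2 * t + 2) ≤ s)
    (hfree : ¬ ∃ A : ZMod (2 * t + 2) → Finset (Fin n),
      IsLinearCycle k (2 * t + 2) A ∧ ∀ i, A i ∈ H) {D D' X : Finset (Fin n)}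
    (hD : IsRich H s (2 * t + 3) D) (hX : X ⊆ tops H s D) (hXt : X.card = t)
    {x : Fin n} (hx : x ∈ tops H s D') (hDD' : 2 ≤ (D ∩ D').card) : x ∈ X := by
  by_contra hxX
  obtain ⟨b, hb, b', hb', hbb⟩ := Finset.one_lt_card.1 hDD'
  rw [Finset.mem_inter] at hb hb'
  have hXD : ∀ c ∈ D, c ∉ X := fun c hc hcX => (mem_tops.1 (hX hcX)).1 hc
  have hxD : ∀ c ∈ D', x ≠ c := fun c hc h => (mem_tops.1 hx).1 (h ▸ hc)
  have hK : ∀ c, c ∈ D ∧ c ∈ D' → ∀ y ∈ insert x X, IsKernel H s {y, c} := by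
    intro c hc y hy
    rcases Finset.mem_insert.1 hy with rfl | hy
    · exact (mem_tops.1 hx).2.2 c hc.2
    · exact (mem_tops.1 (hX hy)).2.2 c hc.1
  exact hfree (exists_linearCycle_of_rich_pairs hk hk2 ht hs X hXt
    (fun x hx y hy hxy => hD x (hX hx) y (hX hy) hxy) x b b' hxX hbb (hXD b hb.1) (hXD b' hb'.1)
    (hxD b hb.2) (hxD b' hb'.2) (hK b hb) (hK b' hb'))

theorem card_tops_le (hk : ∀ e ∈ H, e.card = k) (hk2 : 2 ≤ k) (ht : 1 ≤ t)
    (hs : 2 * k * (2 * t + 2) ≤ s)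
    (hfree : ¬ ∃ A : ZMod (2 * t + 2) → Finset (Fin n),
      IsLinearCycle k (2 * t + 2) A ∧ ∀ i, A i ∈ H) {D : Finset (Fin n)}
    (hD : IsRich H s (2 * t + 3) D) (hD2 : 2 ≤ D.card) : (tops H s D).card ≤ t := by
  by_contra! hlt
  obtain ⟨X, hX, hXt⟩ := Finset.exists_subset_card_eq hlt.le
  have : tops H s D ⊆ X := fun x hx =>
    mem_of_isRich hk hk2 ht hs hfree hD hX hXt hx (by rwa [Finset.inter_self])
  have := Finset.card_le_card this
  omega

theorem tops_eq_tops (hk : ∀ e ∈ H, e.card = k) (hk2 : 2 ≤ k) (ht : 1 ≤ t)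
    (hs : 2 * k * (2 * t + 2) ≤ s)
    (hfree : ¬ ∃ A : ZMod (2 * t + 2) → Finset (Fin n),
      IsLinearCycle k (2 * t + 2) A ∧ ∀ i, A i ∈ H) {D D' : Finset (Fin n)}
    (hD : IsRich H s (2 * t + 3) D) (hDt : (tops H s D).card = t)
    (hDt' : (tops H s D').card = t) (hDD' : 2 ≤ (D ∩ D').card) :
    tops H s D = tops H s D' :=
  (Finset.eq_of_subset_of_card_le (fun _ hx => mem_of_isRich hk hk2 ht hs hfree hD subset_rfl hDt
    hx hDD') (by rw [hDt, hDt'])).symm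

theorem choose_add_le (a t r : ℕ) :
    (a + t).choose (r + 1) ≤ a.choose (r + 1) + t * (a + t) ^ r := by
  induction t with
  | zero => simp
  | succ t ih =>
    have h1 : (a + t).choose r ≤ (a + (t + 1)) ^ r :=
      (Nat.choose_le_pow _ _).trans (Nat.pow_le_pow_left (by omega) _)
    have h2 : t * (a + t) ^ r ≤ t * (a + (t + 1)) ^ r :=
      Nat.mul_le_mul_left _ (Nat.pow_le_pow_left (by omega) _)
    rw [← add_assoc, Nat.choose_succ_succ, Nat.succ_eq_add_one, add_assoc, add_mul]
    omega

theorem mul_choose_le_choose_sub_choose {n t r : ℕ} (htn : t ≤ n) :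
    t * n.choose (r + 1) + (n - t).choose (r + 2) ≤ n.choose (r + 2) + t ^ 2 * n ^ r := by
  obtain ⟨a, rfl⟩ : ∃ a, n = a + t := ⟨n - t, by omega⟩
  have h1 := choose_add_mul_choose_le a t (r + 1)
  have h2 := Nat.mul_le_mul_left t (choose_add_le a t r)
  rw [Nat.add_sub_cancel]
  calc t * (a + t).choose (r + 1) + a.choose (r + 2)
      ≤ t * (a.choose (r + 1) + t * (a + t) ^ r) + a.choose (r + 2) := Nat.add_le_add_right h2 _
    _ = (a.choose (r + 2) + t * a.choose (r + 1)) + t ^ 2 * (a + t) ^ r := by ring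
    _ ≤ _ := Nat.add_le_add_right h1 _

/-- In a large family without linear cycles, almost all `(k - 1)`-sets are rich and have exactly
`t` tops. -/
theorem card_filter_not_isRich_or_card_tops_ne_le (hk : ∀ e ∈ H, e.card = k) (hk5 : 5 ≤ k)
    (ht : 1 ≤ t) (hs : 2 * k * (2 * t + 2) ≤ s) (hn : 1 ≤ n) (htn : t ≤ n)
    (hfree : ¬ ∃ A : ZMod (2 * t + 2) → Finset (Fin n),
      IsLinearCycle k (2 * t + 2) A ∧ ∀ i, A i ∈ H)
    (hcard : n.choose k ≤ H.card + (n - t).choose k) :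
    ((Finset.powersetCard (k - 1) Finset.univ).filter
      fun D => ¬ (IsRich H s (2 * t + 3) D ∧ (tops H s D).card = t)).card ≤
      ((2 ^ k + 1) ^ 2 ^ k * (k * s + 1) ^ k + t ^ 2 + 2 * 2 ^ (2 * t + 2)) * n ^ (k - 2) := by
  set 𝒟 := Finset.powersetCard (k - 1) (Finset.univ : Finset (Fin n)) with h𝒟
  have h1 := card_le_sum_card_tops (s := s) hk
  have h2 := card_filter_not_star_le hk hk5 (by omega) hs hfree
  rw [← h𝒟] at h1
  have h3 : (𝒟.filter fun D => ¬ IsRich H s (2 * t + 3) D).card ≤ n ^ 2 * 2 ^ (2 * t + 2) :=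
    card_filter_not_isRich_le 𝒟 (2 * t + 2)
  have h4 := mul_choose_le_choose_sub_choose (r := k - 2) htn
  rw [show k - 2 + 2 = k by omega, show k - 2 + 1 = k - 1 by omega] at h4
  have h5 : ∑ D ∈ 𝒟, (tops H s D).card +
      (𝒟.filter fun D => ¬ (IsRich H s (2 * t + 3) D ∧ (tops H s D).card = t)).card ≤
      n.choose (k - 1) * t +
        (𝒟.filter fun D => ¬ IsRich H s (2 * t + 3) D).card * (n + 1) := by
    have hcn : n.choose (k - 1) = 𝒟.card := by
      rw [h𝒟, Finset.card_powersetCard, Finset.card_univ, Fintype.card_fin]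
    rw [hcn, ← smul_eq_mul 𝒟.card, ← Finset.sum_const, Finset.card_filter, Finset.card_filter,
      Finset.sum_mul, ← Finset.sum_add_distrib, ← Finset.sum_add_distrib]
    refine Finset.sum_le_sum fun D hD => ?_
    have hDc : D.card = k - 1 := Finset.mem_powersetCard_univ.1 hD
    have hu : (tops H s D).card ≤ n := by
      simpa using Finset.card_le_univ (tops H s D)
    by_cases hR : IsRich H s (2 * t + 3) D
    · have := card_tops_le hk (by omega) ht hs hfree hR (by omega)
      by_cases hc : (tops H s D).card = t
      · simp [hR, hc]
      · simp only [hR, hc, and_false, not_false_iff, if_true, not_true, if_false]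
        omega
    · simp only [hR, false_and, not_false_iff, if_true]
      omega
  have h6 : n ^ 2 * 2 ^ (2 * t + 2) * (n + 1) ≤ 2 * 2 ^ (2 * t + 2) * n ^ (k - 2) := by
    calc n ^ 2 * 2 ^ (2 * t + 2) * (n + 1) ≤ n ^ 2 * 2 ^ (2 * t + 2) * (2 * n) :=
          Nat.mul_le_mul_left _ (by omega)
      _ = 2 * 2 ^ (2 * t + 2) * n ^ 3 := by ring
      _ ≤ _ := Nat.mul_le_mul_left _ (Nat.pow_le_pow_right hn (by omega))
  have h7 := Nat.mul_le_mul_right (n + 1) h3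
  rw [add_mul, add_mul]
  rw [mul_comm t] at h4
  omega

end Tops

section UpperBound

variable {n k s t : ℕ} {H : Finset (Finset (Fin n))}

/-- The points outside `T` that do not form kernels with all points of `T`. -/
noncomputable def exceptional (H : Finset (Finset (Fin n))) (s : ℕ) (T : Finset (Fin n)) :
    Finset (Fin n) :=
  Finset.univ.filter fun v => v ∉ T ∧ ∃ x ∈ T, ¬ IsKernel H s {v, x}

/-- A large family without linear cycles has `t` points that form kernels with all but boundedly
many of the other points. -/
theorem exists_card_exceptional_le {k t : ℕ} (s : ℕ) (hk5 : 5 ≤ k) (ht : 1 ≤ t)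
    (hs : 2 * k * (2 * t + 2) ≤ s) :
    ∃ K n₀ : ℕ, ∀ n ≥ n₀, ∀ H : Finset (Finset (Fin n)), (∀ e ∈ H, e.card = k) →
      (¬ ∃ A : ZMod (2 * t + 2) → Finset (Fin n),
        IsLinearCycle k (2 * t + 2) A ∧ ∀ i, A i ∈ H) →
      n.choose k ≤ H.card + (n - t).choose k →
      ∃ T : Finset (Fin n), T.card = t ∧ (exceptional H s T).card ≤ K := by
  set C := (2 ^ k + 1) ^ 2 ^ k * (k * s + 1) ^ k + t ^ 2 + 2 * 2 ^ (2 * t + 2) with hC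
  set C' := C + 48 * (2 ^ (k - 1 - 4) * (k - 1 - 4).factorial * C * (k - 1).choose 4) with hC'
  obtain ⟨n₁, hn₁⟩ := exists_mul_pow_lt_choose C' 0 (k - 2)
  refine ⟨2 ^ (k - 1 - 1) * (k - 1 - 1).factorial * C' * (k - 1).choose 1,
    n₁ + t + 2 * k + 1, fun n hn H hk hfree hcard => ?_⟩
  set G := (Finset.univ : Finset (Finset (Fin n))).filter
    fun D => IsRich H s (2 * t + 3) D ∧ (tops H s D).card = t with hG
  have hbad := card_filter_not_isRich_or_card_tops_ne_le hk hk5 ht hs (by omega) (by omega)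
    hfree hcard
  have hGmem : ∀ D, D ∈ G ↔ IsRich H s (2 * t + 3) D ∧ (tops H s D).card = t := by
    simp [hG]
  obtain ⟨T, hT⟩ := exists_color_of_almost_all (r := k - 1) (C := C) (by omega)
    (by rw [Fintype.card_fin]; omega) G (tops H s)
    (by simpa only [hGmem, Fintype.card_fin, show k - 1 - 1 = k - 2 by omega] using hbad)
    (fun D hD D' hD' h => by
      rw [hGmem] at hD hD'
      exact tops_eq_tops hk (by omega) ht hs hfree hD.1 hD.2 hD'.2 h)
  rw [← hC'] at hT
  set B := (Finset.powersetCard (k - 1) Finset.univ).filter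
    fun D => ¬ (D ∈ G ∧ tops H s D = T) with hB
  have hTt : T.card = t := by
    have h1 : ∃ D : Finset (Fin n), D ∈ Finset.powersetCard (k - 1) Finset.univ ∧ D ∉ B := by
      by_contra! hcon
      have h2 := (Finset.card_le_card hcon).trans hT
      rw [Finset.card_powersetCard, Finset.card_univ, Fintype.card_fin] at h2
      have h3 := hn₁ n (by omega)
      rw [show k - 2 + 1 = k - 1 by omega, Nat.sub_zero] at h3
      rw [show k - 1 - 1 = k - 2 by omega] at h2
      omega
    obtain ⟨D, hD, hDB⟩ := h1
    rw [hB, Finset.mem_filter, not_and, not_not] at hDB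
    obtain ⟨h2, h3⟩ := hDB hD
    rw [← h3]
    exact ((hGmem D).1 h2).2
  refine ⟨T, hTt, ?_⟩
  have := card_le_of_supersets_subset (a := 1) (r := k - 1) (C := C') (j := 0) (by omega)
    (by rw [Fintype.card_fin]; omega) (by rw [Fintype.card_fin]; omega)
    (Finset.powersetCard 1 (exceptional H s T)) B
    (fun P hP => (Finset.mem_powersetCard.1 hP).2)
    (fun D hD => Finset.mem_powersetCard_univ.1 (Finset.mem_filter.1 hD).1)
    (by rwa [zero_add]) (fun P hP D hD hPD => by
      refine Finset.mem_filter.2 ⟨Finset.mem_powersetCard_univ.2 hD, fun h => ?_⟩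
      rw [Finset.mem_powersetCard] at hP
      obtain ⟨v, rfl⟩ := Finset.card_eq_one.1 hP.2
      rw [Finset.singleton_subset_iff] at hP hPD
      obtain ⟨-, -, x, hx, hvx⟩ := Finset.mem_filter.1 hP.1
      rw [← h.2] at hx
      apply hvx
      rw [Finset.pair_comm]
      exact (mem_tops.1 hx).2.2 v hPD)
  simpa using this

theorem card_filter_not_disjoint_eq (T : Finset (Fin n)) (hT : T.card = t) :
    ((Finset.powersetCard k (Finset.univ : Finset (Fin n))).filter
      fun e => ¬ Disjoint e T).card + (n - t).choose k = n.choose k := by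
  have h1 := Finset.card_filter_add_card_filter_not
    (s := Finset.powersetCard k (Finset.univ : Finset (Fin n))) (fun e => Disjoint e T)
  have h2 : ((Finset.powersetCard k (Finset.univ : Finset (Fin n))).filter
      fun e => Disjoint e T) = Finset.powersetCard k Tᶜ := by
    ext e
    rw [Finset.mem_filter, Finset.mem_powersetCard_univ, Finset.mem_powersetCard,
      Finset.subset_compl_iff_disjoint_right, and_comm]
  rw [h2, Finset.card_powersetCard, Finset.card_powersetCard, Finset.card_compl,
    Fintype.card_fin, Finset.card_univ, Fintype.card_fin, hT] at h1
  omega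

/-- A pair that is not a kernel is contained in many sets that are not in the family. -/
theorem choose_le_card_missing (hs : s + 2 ≤ n) (hk2 : 2 ≤ k) {T : Finset (Fin n)} {v x : Fin n}
    (hv : v ∉ T) (hx : x ∈ T) (hvx : ¬ IsKernel H s {v, x}) :
    (n - (s + 2)).choose (k - 2) ≤
      ((Finset.powersetCard k Finset.univ).filter fun e => ¬ Disjoint e T ∧ e ∉ H).card := by
  rw [IsKernel] at hvx
  push Not at hvx
  obtain ⟨U, hU, hUe⟩ := hvx
  have hne : v ≠ x := fun h => hv (h ▸ hx)
  have hcard : n - (s + 2) ≤ (U ∪ {v, x})ᶜ.card := by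
    have h1 := Finset.card_union_le U {v, x}
    rw [Finset.card_pair hne] at h1
    rw [Finset.card_compl, Fintype.card_fin]
    omega
  refine (Nat.choose_le_choose _ hcard).trans ?_
  rw [← Finset.card_powersetCard]
  have hR : ∀ R ∈ Finset.powersetCard (k - 2) (U ∪ {v, x})ᶜ,
      Disjoint R U ∧ Disjoint R {v, x} ∧ R.card = k - 2 := by
    intro R hR
    rwa [Finset.mem_powersetCard, Finset.subset_compl_iff_disjoint_right,
      Finset.disjoint_union_right, and_assoc] at hR
  refine Finset.card_le_card_of_injOn (fun R => R ∪ {v, x}) (fun R h => ?_)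
    fun R h R' h' heq => ?_
  · obtain ⟨h1, h2, h3⟩ := hR R h
    simp only [Finset.mem_coe, Finset.mem_filter, Finset.mem_powersetCard_univ]
    refine ⟨?_, ?_, fun hH => ?_⟩
    · rw [Finset.card_union_of_disjoint h2, Finset.card_pair hne]
      omega
    · exact Finset.not_disjoint_iff.2 ⟨x, by simp, hx⟩
    · exact hUe _ hH Finset.subset_union_right (by rwa [Finset.union_sdiff_cancel_right h2])
  · rw [← Finset.union_sdiff_cancel_right (hR R h).2.1,
      ← Finset.union_sdiff_cancel_right (hR R' h').2.1]
    simp only at heq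
    rw [heq]

/-- The bound for families without singleton intersections, for families avoiding `T`. -/
theorem card_le_of_disjoint_of_card_inter_ne_one {m₀ : ℕ}
    (hfrankl : ∀ (α : Type) [Fintype α] [DecidableEq α] (F : Finset (Finset α)),
      m₀ ≤ Fintype.card α → (∀ e ∈ F, e.card = k) →
      (∀ e ∈ F, ∀ f ∈ F, (e ∩ f).card ≠ 1) →
      F.card ≤ (Fintype.card α - 2).choose (k - 2))
    (T : Finset (Fin n)) (hT : T.card = t) (hn : m₀ + t ≤ n)
    (hk : ∀ e ∈ H, e.card = k) (hHT : ∀ e ∈ H, Disjoint e T)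
    (hH : ∀ e ∈ H, ∀ f ∈ H, (e ∩ f).card ≠ 1) :
    H.card ≤ (n - t - 2).choose (k - 2) := by
  have hcard : Fintype.card {v : Fin n // v ∉ T} = n - t := by
    rw [Fintype.card_subtype_compl, Fintype.card_fin, Fintype.card_coe, hT]
  have hsub : ∀ e : Finset (Fin n), Disjoint e T →
      (e.subtype (· ∉ T)).map (Function.Embedding.subtype _) = e := by
    intro e he
    rw [Finset.subtype_map, Finset.filter_true_of_mem]
    exact fun x hx => Finset.disjoint_left.1 he hx
  have hsubcard : ∀ e : Finset (Fin n), Disjoint e T →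
      (e.subtype (· ∉ T)).card = e.card := by
    intro e he
    conv_rhs => rw [← hsub e he, Finset.card_map]
  have hinj : Set.InjOn (fun e : Finset (Fin n) => e.subtype (· ∉ T)) H := by
    intro e he f hf h
    simp only at h
    rw [← hsub e (hHT e he), h, hsub f (hHT f hf)]
  have := hfrankl {v : Fin n // v ∉ T} (H.image fun e => e.subtype (· ∉ T))
    (by rw [hcard]; omega)
    (fun e he => by
      obtain ⟨e, heH, rfl⟩ := Finset.mem_image.1 he
      rw [hsubcard e (hHT e heH), hk e heH])
    (fun e he f hf => by
      obtain ⟨e, heH, rfl⟩ := Finset.mem_image.1 he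
      obtain ⟨f, hfH, rfl⟩ := Finset.mem_image.1 hf
      have h1 : e.subtype (· ∉ T) ∩ f.subtype (· ∉ T) = (e ∩ f).subtype (· ∉ T) := by
        ext x
        simp
      rw [h1, hsubcard _ ((hHT e heH).mono_left Finset.inter_subset_left)]
      exact hH e heH f hfH)
  rwa [Finset.card_image_of_injOn hinj, hcard] at this

theorem card_filter_exceptional_le {K : ℕ} (hk : ∀ e ∈ H, e.card = k) (V : Finset (Fin n))
    (hV : V.card ≤ K) :
    (H.filter fun e => 3 ≤ (e ∩ V).card).card ≤ K ^ 3 * n ^ (k - 3) := by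
  refine (Finset.card_le_card (t := (Finset.powersetCard 3 V).biUnion fun Q =>
    (Finset.powersetCard k Finset.univ).filter fun D => Q ⊆ D) fun e he => ?_).trans
    ((Finset.card_biUnion_le_card_mul _ _ (n ^ (k - 3)) fun Q hQ => ?_).trans
      (Nat.mul_le_mul_right _ ?_))
  · rw [Finset.mem_filter] at he
    obtain ⟨Q, hQ, hQ3⟩ := Finset.exists_subset_card_eq he.2
    exact Finset.mem_biUnion.2 ⟨Q, Finset.mem_powersetCard.2
      ⟨hQ.trans Finset.inter_subset_right, hQ3⟩, Finset.mem_filter.2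
      ⟨Finset.mem_powersetCard_univ.2 (hk e he.1), hQ.trans Finset.inter_subset_left⟩⟩
  · have := card_filter_superset_le Q k
    rwa [(Finset.mem_powersetCard.1 hQ).2, Fintype.card_fin] at this
  · rw [Finset.card_powersetCard]
    exact (Nat.choose_le_pow _ _).trans (Nat.pow_le_pow_left hV 3)

theorem card_inter_ne_one_of_card_inter_exceptional_le (hk : ∀ e ∈ H, e.card = k) (hk5 : 5 ≤ k)
    (ht : 1 ≤ t) (hs : 2 * k * (2 * t + 2) ≤ s)
    (hfree : ¬ ∃ A : ZMod (2 * t + 2) → Finset (Fin n),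
      IsLinearCycle k (2 * t + 2) A ∧ ∀ i, A i ∈ H) {T : Finset (Fin n)} (hT : T.card = t)
    (hn : 3 * t + 1 + 2 * k + (exceptional H s T).card ≤ n) {e f : Finset (Fin n)} (he : e ∈ H)
    (hf : f ∈ H) (heT : Disjoint e T) (hfT : Disjoint f T)
    (heV : (e ∩ exceptional H s T).card ≤ 2) (hfV : (f ∩ exceptional H s T).card ≤ 2) :
    (e ∩ f).card ≠ 1 := by
  intro hef
  set V := exceptional H s T with hV
  have hpoint : ∀ e f : Finset (Fin n), e ∈ H → Disjoint e T → (e ∩ V).card ≤ 2 →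
      (e ∩ f).card = 1 → ∃ u ∈ e, u ∉ f ∧ u ∈ (T ∪ V)ᶜ := by
    intro e f he heT heV hef
    by_contra! hcon
    have hsub : e ⊆ (e ∩ f) ∪ (e ∩ V) := by
      intro u hu
      by_cases huf : u ∈ f
      · exact Finset.mem_union_left _ (Finset.mem_inter.2 ⟨hu, huf⟩)
      · have h1 := hcon u hu huf
        rw [Finset.mem_compl, not_not, Finset.mem_union] at h1
        exact Finset.mem_union_right _ (Finset.mem_inter.2
          ⟨hu, h1.resolve_left (Finset.disjoint_left.1 heT hu)⟩)
    have h1 := (Finset.card_le_card hsub).trans (Finset.card_union_le _ _)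
    rw [hk e he] at h1
    omega
  obtain ⟨z, hz⟩ := Finset.card_eq_one.1 hef
  obtain ⟨u, hu, huf, huW⟩ := hpoint e f he heT heV hef
  obtain ⟨v, hv, hve, hvW⟩ := hpoint f e hf hfT hfV (by rwa [Finset.inter_comm])
  refine hfree (exists_linearCycle_of_two_edges hk (by omega) ht hs T (T ∪ V)ᶜ hT
    (fun x hx w hw => ?_) ?_ he hf heT hfT hz hu huf huW hv hve hvW)
  · rw [Finset.mem_compl, Finset.mem_union, not_or] at hw
    by_contra hxw
    exact hw.2 (Finset.mem_filter.2 ⟨Finset.mem_univ _, hw.1, x, hx, hxw⟩)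
  · have h1 := Finset.card_union_le T V
    rw [Finset.card_compl, Fintype.card_fin]
    omega

theorem exists_forall_card_le {k t : ℕ} (hk5 : 5 ≤ k) (ht : 1 ≤ t) :
    ∃ n₀ : ℕ, ∀ n ≥ n₀, ∀ H : Finset (Finset (Fin n)), (∀ e ∈ H, e.card = k) →
      (¬ ∃ A : ZMod (2 * t + 2) → Finset (Fin n),
        IsLinearCycle k (2 * t + 2) A ∧ ∀ i, A i ∈ H) →
      H.card ≤ n.choose k - (n - t).choose k + (n - t - 2).choose (k - 2) := by
  obtain ⟨s, hs⟩ : ∃ s, s = 2 * k * (2 * t + 2) := ⟨_, rfl⟩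
  obtain ⟨K, n₁, h₁⟩ := exists_card_exceptional_le s hk5 ht hs.ge
  obtain ⟨m₀, hfrankl⟩ := exists_forall_card_le_choose_of_card_inter_ne_one hk5
  obtain ⟨n₂, h₂⟩ := exists_mul_pow_lt_choose (K ^ 3) (s + 2) (k - 3)
  refine ⟨n₁ + n₂ + m₀ + 3 * t + 2 * k + 1 + K + s + 2, fun n hn H hk hfree => ?_⟩
  rcases Nat.lt_or_ge (H.card + (n - t).choose k) (n.choose k) with hlt | hcard
  · omega
  obtain ⟨T, hT, hTK⟩ := h₁ n (by omega) H hk hfree hcard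
  set V := exceptional H s T with hV
  set P := (Finset.powersetCard k (Finset.univ : Finset (Fin n))) with hP
  have e1 := Finset.card_filter_add_card_filter_not (s := H) (fun e => Disjoint e T)
  have e2 := Finset.card_filter_add_card_filter_not (s := H.filter fun e => Disjoint e T)
    (fun e => (e ∩ V).card ≤ 2)
  have e3 : (H.filter fun e => ¬ Disjoint e T).card +
      (P.filter fun e => ¬ Disjoint e T ∧ e ∉ H).card ≤
      (P.filter fun e => ¬ Disjoint e T).card := by
    rw [← Finset.card_union_of_disjoint]
    · refine Finset.card_le_card fun e he => ?_
      rw [Finset.mem_union, Finset.mem_filter, Finset.mem_filter] at he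
      rw [Finset.mem_filter]
      rcases he with he | he
      · exact ⟨Finset.mem_powersetCard_univ.2 (hk e he.1), he.2⟩
      · exact ⟨he.1, he.2.1⟩
    · rw [Finset.disjoint_left]
      intro e he he'
      exact (Finset.mem_filter.1 he').2.2 (Finset.mem_filter.1 he).1
  have e4 := card_filter_not_disjoint_eq (k := k) T hT
  rw [← hP] at e4
  have e5 : ((H.filter fun e => Disjoint e T).filter fun e => (e ∩ V).card ≤ 2).card ≤
      (n - t - 2).choose (k - 2) := by
    refine card_le_of_disjoint_of_card_inter_ne_one hfrankl T hT (by omega) (fun e he => ?_)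
      (fun e he => ?_) fun e he f hf => ?_
    · exact hk e (Finset.mem_filter.1 (Finset.mem_filter.1 he).1).1
    · exact (Finset.mem_filter.1 (Finset.mem_filter.1 he).1).2
    · rw [Finset.mem_filter, Finset.mem_filter] at he hf
      exact card_inter_ne_one_of_card_inter_exceptional_le hk hk5 ht hs.ge hfree hT
        (by rw [← hV]; omega)
        he.1.1 hf.1.1 he.1.2 hf.1.2 he.2 hf.2
  have e6 : ((H.filter fun e => Disjoint e T).filter fun e => ¬ (e ∩ V).card ≤ 2).card ≤
      (P.filter fun e => ¬ Disjoint e T ∧ e ∉ H).card := by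
    rcases V.eq_empty_or_nonempty with hV0 | ⟨v, hv⟩
    · simp [hV0]
    · obtain ⟨-, hvT, x, hx, hvx⟩ := Finset.mem_filter.1 hv
      refine le_trans ?_ (choose_le_card_missing (by omega) (by omega) hvT hx hvx)
      have h3 := h₂ n (by omega)
      rw [show k - 3 + 1 = k - 2 by omega] at h3
      refine (le_trans (Finset.card_le_card fun e he => ?_)
        (card_filter_exceptional_le hk V hTK)).trans h3.le
      rw [Finset.mem_filter, Finset.mem_filter] at he
      exact Finset.mem_filter.2 ⟨he.1.1, by omega⟩
  omega

end UpperBound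

section LowerBound

variable {n k ℓ t : ℕ}

theorem IsLinearCycle.eq_add_one_or_eq_add_one {A : ZMod ℓ → Finset (Fin n)}
    (hA : IsLinearCycle k ℓ A) {i j : ZMod ℓ} (hij : i ≠ j) (h : ¬ Disjoint (A i) (A j)) :
    j = i + 1 ∨ i = j + 1 := by
  by_contra hcon
  rw [not_or] at hcon
  exact h (hA.2.2.2 i j hij.symm hcon.1 hcon.2)

theorem IsLinearCycle.card_inter_le_one {A : ZMod ℓ → Finset (Fin n)}
    (hA : IsLinearCycle k ℓ A) {i j : ZMod ℓ} (hij : i ≠ j) : (A i ∩ A j).card ≤ 1 := by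
  by_cases h : Disjoint (A i) (A j)
  · rw [Finset.disjoint_iff_inter_eq_empty.1 h]
    simp
  · rcases hA.eq_add_one_or_eq_add_one hij h with rfl | rfl
    · exact (hA.2.2.1 i).le
    · rw [Finset.inter_comm]
      exact (hA.2.2.1 j).le

theorem IsLinearCycle.card_filter_mem_le_two [NeZero ℓ] (hℓ : 4 ≤ ℓ)
    {A : ZMod ℓ → Finset (Fin n)} (hA : IsLinearCycle k ℓ A) (x : Fin n) :
    (Finset.univ.filter fun i => x ∈ A i).card ≤ 2 := by
  by_contra! hlt
  obtain ⟨a, b, c, ha, hb, hc, hab, hac, hbc⟩ := Finset.two_lt_card_iff.1 hlt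
  simp only [Finset.mem_filter, Finset.mem_univ, true_and] at ha hb hc
  have h3 : (3 : ZMod ℓ) ≠ 0 := by
    intro h
    have h' : ((3 : ℕ) : ZMod ℓ) = 0 := by exact_mod_cast h
    rw [ZMod.natCast_eq_zero_iff] at h'
    have := Nat.le_of_dvd (by norm_num) h'
    omega
  have h1 := hA.eq_add_one_or_eq_add_one hab (Finset.not_disjoint_iff.2 ⟨x, ha, hb⟩)
  have h2 := hA.eq_add_one_or_eq_add_one hac (Finset.not_disjoint_iff.2 ⟨x, ha, hc⟩)
  have h4 := hA.eq_add_one_or_eq_add_one hbc (Finset.not_disjoint_iff.2 ⟨x, hb, hc⟩)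
  grind

/-- The sets meeting `T`, together with the sets containing a fixed pair, contain no linear cycle
of length `2t+2`. -/
theorem not_isLinearCycle_of_disjoint_imp_subset (ht : 1 ≤ t) {T Z : Finset (Fin n)}
    (hT : T.card = t) (hZ : Z.card = 2) {A : ZMod (2 * t + 2) → Finset (Fin n)}
    (h : ∀ i, Disjoint (A i) T → Z ⊆ A i) : ¬ IsLinearCycle k (2 * t + 2) A := by
  intro hA
  have h1 : (Finset.univ.filter fun i => Disjoint (A i) T).card ≤ 1 := by
    rw [Finset.card_le_one]
    intro i hi j hj
    by_contra hij
    have h2 := hA.card_inter_le_one hij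
    have h3 := Finset.card_le_card (Finset.subset_inter (h i (Finset.mem_filter.1 hi).2)
      (h j (Finset.mem_filter.1 hj).2))
    omega
  have h2 : (Finset.univ.filter fun i => ¬ Disjoint (A i) T).card ≤ T.card * 2 := by
    refine (Finset.card_le_card (t := T.biUnion fun x => Finset.univ.filter fun i => x ∈ A i)
      fun i hi => ?_).trans (Finset.card_biUnion_le_card_mul _ _ _ fun x _ =>
        hA.card_filter_mem_le_two (by omega) x)
    obtain ⟨x, hx, hxT⟩ := Finset.not_disjoint_iff.1 (Finset.mem_filter.1 hi).2
    exact Finset.mem_biUnion.2 ⟨x, hxT, Finset.mem_filter.2 ⟨Finset.mem_univ _, hx⟩⟩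
  have h3 := Finset.card_filter_add_card_filter_not (s := (Finset.univ : Finset (ZMod (2 * t + 2))))
    (fun i => Disjoint (A i) T)
  rw [Finset.card_univ, ZMod.card] at h3
  omega

theorem exists_family_without_linearCycle (hk2 : 2 ≤ k) (ht : 1 ≤ t) (hn : t + 2 ≤ n) :
    ∃ H : Finset (Finset (Fin n)), (∀ e ∈ H, e.card = k) ∧
      (¬ ∃ A : ZMod (2 * t + 2) → Finset (Fin n),
        IsLinearCycle k (2 * t + 2) A ∧ ∀ i, A i ∈ H) ∧
      n.choose k - (n - t).choose k + (n - t - 2).choose (k - 2) ≤ H.card := by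
  obtain ⟨T, -, hT⟩ := Finset.exists_subset_card_eq (s := (Finset.univ : Finset (Fin n))) (n := t)
    (by rw [Finset.card_univ, Fintype.card_fin]; omega)
  obtain ⟨Z, hZT, hZ⟩ := Finset.exists_subset_card_eq (s := Tᶜ) (n := 2)
    (by rw [Finset.card_compl, Fintype.card_fin]; omega)
  rw [Finset.subset_compl_iff_disjoint_right] at hZT
  refine ⟨(Finset.powersetCard k Finset.univ).filter fun e => Disjoint e T → Z ⊆ e,
    fun e he => Finset.mem_powersetCard_univ.1 (Finset.mem_filter.1 he).1, ?_, ?_⟩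
  · rintro ⟨A, hA, hAH⟩
    exact not_isLinearCycle_of_disjoint_imp_subset ht hT hZ
      (fun i => (Finset.mem_filter.1 (hAH i)).2) hA
  have h1 := card_filter_not_disjoint_eq (k := k) T hT
  have hR : ∀ R ∈ Finset.powersetCard (k - 2) (T ∪ Z)ᶜ,
      Disjoint R T ∧ Disjoint R Z ∧ R.card = k - 2 := by
    intro R hR
    rwa [Finset.mem_powersetCard, Finset.subset_compl_iff_disjoint_right,
      Finset.disjoint_union_right, and_assoc] at hR
  have h2 : ((Finset.powersetCard (k - 2) (T ∪ Z)ᶜ).image (fun R => R ∪ Z)).card =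
      (n - t - 2).choose (k - 2) := by
    rw [Finset.card_image_of_injOn, Finset.card_powersetCard, Finset.card_compl, Fintype.card_fin,
      Finset.card_union_of_disjoint hZT.symm, hT, hZ, Nat.sub_sub]
    intro R h R' h' heq
    rw [← Finset.union_sdiff_cancel_right (hR R h).2.1,
      ← Finset.union_sdiff_cancel_right (hR R' h').2.1]
    simp only at heq
    rw [heq]
  have h3 : Disjoint ((Finset.powersetCard k Finset.univ).filter fun e => ¬ Disjoint e T)
      ((Finset.powersetCard (k - 2) (T ∪ Z)ᶜ).image (fun R => R ∪ Z)) := by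
    rw [Finset.disjoint_left]
    intro e he he'
    obtain ⟨R, hR', rfl⟩ := Finset.mem_image.1 he'
    exact (Finset.mem_filter.1 he).2 (Finset.disjoint_union_left.2 ⟨(hR R hR').1, hZT⟩)
  have h4 : ((Finset.powersetCard k Finset.univ).filter fun e => ¬ Disjoint e T) ∪
      ((Finset.powersetCard (k - 2) (T ∪ Z)ᶜ).image (fun R => R ∪ Z)) ⊆
      (Finset.powersetCard k Finset.univ).filter fun e => Disjoint e T → Z ⊆ e := by
    intro e he
    rw [Finset.mem_filter]
    rcases Finset.mem_union.1 he with he | he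
    · rw [Finset.mem_filter] at he
      exact ⟨he.1, fun h => absurd h he.2⟩
    · obtain ⟨R, hR', rfl⟩ := Finset.mem_image.1 he
      obtain ⟨a1, a2, a3⟩ := hR R hR'
      refine ⟨Finset.mem_powersetCard_univ.2 ?_, fun _ => Finset.subset_union_right⟩
      rw [Finset.card_union_of_disjoint a2, a3, hZ]
      omega
  have h5 := Finset.card_le_card h4
  rw [Finset.card_union_of_disjoint h3, h2] at h5
  omega

end LowerBound

/-- Theorem 3, even case: for `k ≥ 5` and sufficiently large `n`, the Turán number of the `k`-uniform linear cycle of length `2t+2` is `C(n,k) - C(n-t,k) + C(n-t-2,k-2)`. -/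
theorem turan_linear_cycle_even (k t : ℕ) (hk : 5 ≤ k) (ht : 1 ≤ t) :
    ∃ n₀ : ℕ, ∀ n ≥ n₀,
      IsGreatest {m : ℕ | ∃ H : Finset (Finset (Fin n)),
          (∀ e ∈ H, e.card = k) ∧
          (¬ ∃ A : ZMod (2 * t + 2) → Finset (Fin n),
              IsLinearCycle k (2 * t + 2) A ∧ ∀ i, A i ∈ H) ∧
          H.card = m}
        (Nat.choose n k - Nat.choose (n - t) k + Nat.choose (n - t - 2) (k - 2)) := by
  obtain ⟨n₀, h⟩ := exists_forall_card_le hk ht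
  refine ⟨n₀ + t + 2, fun n hn => ⟨?_, ?_⟩⟩
  · obtain ⟨H, hHk, hfree, hcard⟩ :=
      exists_family_without_linearCycle (k := k) (t := t) (n := n) (by omega) ht (by omega)
    exact ⟨H, hHk, hfree, le_antisymm (h n (by omega) H hHk hfree) hcard⟩
  · rintro m ⟨H, hHk, hfree, rfl⟩
    exact h n (by omega) H hHk hfree
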